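/- arXiv:1707.05105 — 2 statements merged into one kernel-verified Lean document; each statement's English description precedes it below -/
import Mathlib

section
/- Let G be a generalised dihedral group over an abelian group A with |G| > 2. Then G does not admit an oriented regular representation: every generating set S of G contains an involution, so S ∩ S^{-1} ≠ ∅ for any generating set S, and no Cayley digraph Cay(G,S) with S ∩ S^{-1} = ∅ can have Aut(Cay(G,S)) = G. -/
section Defs

variable {G : Type*} [Group G]

/-- A permutation of `G` is an automorphism of the Cayley digraph `Cay(G,S)`
(whose arcs are pairs `(x,y)` with `y * x⁻¹ ∈ S`). -/
def IsCayleyAut (S : Set G) (φ : Equiv.Perm G) : Prop :=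
  ∀ x y : G, y * x⁻¹ ∈ S ↔ φ y * (φ x)⁻¹ ∈ S

/-- `Cay(G,S)` is a digraphical regular representation of `G`: every automorphism of the
Cayley digraph is a right translation. -/
def IsCayleyDRR (S : Set G) : Prop :=
  ∀ φ : Equiv.Perm G, IsCayleyAut S φ → ∃ g : G, ∀ v : G, φ v = v * g

/-- `G` admits an oriented regular representation. -/
def HasORR (H : Type*) [Group H] : Prop :=
  ∃ S : Set H, S ∩ S⁻¹ = ∅ ∧ IsCayleyDRR S

/-- `G` is a generalised dihedral group: it is generated by an abelian subgroup `A`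
together with an involution `τ` inverting every element of `A`. -/
def IsGeneralizedDihedral (H : Type*) [Group H] : Prop :=
  ∃ A : Subgroup H, (∀ a ∈ A, ∀ b ∈ A, a * b = b * a) ∧
    ∃ τ : H, τ ∉ A ∧ τ * τ = 1 ∧ (∀ a ∈ A, τ * a * τ = a⁻¹) ∧
      ∀ g : H, g ∈ A ∨ ∃ a ∈ A, g = a * τ

/-- The Imrich connection set with respect to the generating tuple `z 0, …, z (k-1)`. -/
def imrichSet (k : ℕ) (z : ℕ → G) : Set G :=
  z '' Set.Iio k ∪ {g | ∃ i, i + 1 < k ∧ g = z i * z (i + 1)} ∪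
    {z 0 * z 1 * z (k - 3) * z (k - 2), z 0 * z 1 * z (k - 2) * z (k - 1)}

end Defs

/-- A generalised dihedral group `G` over an abelian subgroup `A`, with `|G| > 2`,
does not admit an oriented regular representation: every generating set of `G` contains
an involution, hence meets its own set of inverses, and no Cayley digraph `Cay(G,S)`
with `S ∩ S⁻¹ = ∅` has automorphism group equal to the right regular representation. -/
theorem generalizedDihedral_no_ORR {G : Type*} [Group G] [Finite G]
    (A : Subgroup G) (hA : ∀ a ∈ A, ∀ b ∈ A, a * b = b * a)
    (τ : G) (hτA : τ ∉ A) (hτ2 : τ * τ = 1)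
    (hinv : ∀ a ∈ A, τ * a * τ = a⁻¹)
    (hcover : ∀ g : G, g ∈ A ∨ ∃ a ∈ A, g = a * τ)
    (hcard : 2 < Nat.card G) :
    (∀ S : Set G, Subgroup.closure S = ⊤ →
        (∃ s ∈ S, orderOf s = 2) ∧ S ∩ S⁻¹ ≠ ∅) ∧
      ¬ HasORR G := by
  classical
  have hout : ∀ g : G, g ∉ A → g * g = 1 := by
    intro g hg
    rcases hcover g with h | ⟨a, ha, rfl⟩
    · exact absurd h hg
    · calc a * τ * (a * τ) = a * (τ * a * τ) := by group
        _ = 1 := by rw [hinv a ha, mul_inv_cancel]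
  have hmem : ∀ S : Set G, S ∩ S⁻¹ = ∅ → ∀ s ∈ S, s ∈ A := by
    intro S hS s hs
    by_contra hsA
    have h : s ∈ S ∩ S⁻¹ := ⟨hs, by
      rw [Set.mem_inv, inv_eq_of_mul_eq_one_left (hout s hsA)]; exact hs⟩
    rw [hS] at h
    exact h
  refine ⟨?_, ?_⟩
  · intro S hS
    have hex : ∃ s ∈ S, s ∉ A := by
      by_contra! h
      have h2 : Subgroup.closure S ≤ A := (Subgroup.closure_le A).2 h
      rw [hS] at h2
      exact hτA (h2 (Subgroup.mem_top τ))
    obtain ⟨s, hs, hsA⟩ := hex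
    refine ⟨⟨s, hs, ?_⟩, fun h => hsA (hmem S h s hs)⟩
    apply orderOf_eq_prime
    · rw [pow_two, hout s hsA]
    · rintro rfl
      exact hsA A.one_mem
  · rintro ⟨S, hS, hD⟩
    have hSA := hmem S hS
    obtain ⟨a, ha, ha1⟩ : ∃ a ∈ A, a ≠ 1 := by
      by_contra! h
      have hsub : (Set.univ : Set G) ⊆ {1, τ} := by
        intro g _
        rcases hcover g with hg | ⟨b, hb, rfl⟩
        · simp [h g hg]
        · simp [h b hb]
      have h1 := Set.ncard_le_ncard hsub (Set.toFinite _)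
      have h2 := Set.ncard_insert_le (1 : G) {τ}
      rw [Set.ncard_univ] at h1
      rw [Set.ncard_singleton] at h2
      omega
    have hra : ∀ x, x * a ∈ A ↔ x ∈ A := fun x => A.mul_mem_cancel_right ha
    have hra' : ∀ x, x * a⁻¹ ∈ A ↔ x ∈ A := fun x => A.mul_mem_cancel_right (A.inv_mem ha)
    let φ : Equiv.Perm G :=
      { toFun := fun x => if x ∈ A then x else x * a
        invFun := fun x => if x ∈ A then x else x * a⁻¹
        left_inv := by
          intro x
          by_cases hx : x ∈ A <;> simp [hx, hra]
        right_inv := by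
          intro x
          by_cases hx : x ∈ A <;> simp [hx, hra'] }
    have hin : ∀ x, x ∈ A → φ x = x := fun x hx => if_pos hx
    have hno : ∀ x, x ∉ A → φ x = x * a := fun x hx => if_neg hx
    have haut : IsCayleyAut S φ := by
      intro x y
      by_cases hx : x ∈ A <;> by_cases hy : y ∈ A
      · rw [hin x hx, hin y hy]
      · rw [hin x hx, hno y hy]
        refine ⟨fun h => absurd (hSA _ h) ?_, fun h => absurd (hSA _ h) ?_⟩
        · rwa [A.mul_mem_cancel_right (A.inv_mem hx)]
        · rwa [A.mul_mem_cancel_right (A.inv_mem hx), hra]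
      · rw [hno x hx, hin y hy]
        refine ⟨fun h => absurd (hSA _ h) ?_, fun h => absurd (hSA _ h) ?_⟩
        · rwa [A.mul_mem_cancel_left hy, A.inv_mem_iff]
        · rwa [A.mul_mem_cancel_left hy, A.inv_mem_iff, hra]
      · rw [hno x hx, hno y hy]
        have : y * a * (x * a)⁻¹ = y * x⁻¹ := by group
        rw [this]
    obtain ⟨g, hg⟩ := hD φ haut
    have h1 := hg 1
    rw [hin 1 A.one_mem, one_mul] at h1
    have h2 := hg τ
    rw [hno τ hτA, ← h1] at h2
    exact ha1 (mul_left_cancel h2)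
end

section
/- Let G be a finite group admitting a beautiful generating tuple. Then G admits an oriented regular representation if and only if G is not isomorphic to Q8, not isomorphic to C3 × C2^3, and not isomorphic to C3 × C3. -/
/-- The tuple `g 0, …, g (d-1)` is a *beautiful* generating tuple:
it is an irredundant generating set, every entry has order greater than 2,
and the product of each entry with the inverse of the previous entry
has order greater than 2. -/
def IsBeautiful {G : Type*} [Group G] {d : ℕ} (g : Fin d → G) : Prop :=
  Subgroup.closure (Set.range g) = ⊤ ∧
  (∀ i : Fin d, Subgroup.closure (g '' {j | j ≠ i}) ≠ ⊤) ∧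
  (∀ i : Fin d, 2 < orderOf (g i)) ∧
  (∀ i : ℕ, ∀ h : i + 1 < d,
    2 < orderOf (g ⟨i + 1, h⟩ * (g ⟨i, Nat.lt_of_succ_lt h⟩)⁻¹))


namespace ORR

variable {G : Type*} [Group G]

/-- Shifted automorphism. -/
def shiftAut (φ : Equiv.Perm G) (y : G) : Equiv.Perm G :=
  ((Equiv.mulRight y).trans φ).trans (Equiv.mulRight (φ y)⁻¹)

lemma shiftAut_apply (φ : Equiv.Perm G) (y z : G) :
    shiftAut φ y z = φ (z * y) * (φ y)⁻¹ := rfl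

lemma shiftAut_one (φ : Equiv.Perm G) (y : G) : shiftAut φ y 1 = 1 := by
  simp [shiftAut_apply]

lemma shiftAut_aut {S : Set G} {φ : Equiv.Perm G} (h : IsCayleyAut S φ) (y : G) :
    IsCayleyAut S (shiftAut φ y) := by
  intro a b
  rw [shiftAut_apply, shiftAut_apply]
  have := h (a * y) (b * y)
  have e1 : b * y * (a * y)⁻¹ = b * a⁻¹ := by group
  have e2 : φ (b * y) * (φ y)⁻¹ * (φ (a * y) * (φ y)⁻¹)⁻¹ = φ (b * y) * (φ (a * y))⁻¹ := by group
  rw [e2, ← this, e1]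

/-- The subgroup of elements fixed by every automorphism fixing `1`. -/
def FixSub (S : Set G) : Subgroup G where
  carrier := {x | ∀ φ : Equiv.Perm G, IsCayleyAut S φ → φ 1 = 1 → φ x = x}
  one_mem' := fun _ _ h => h
  mul_mem' := by
    intro a b ha hb φ h1 h2
    have := ha _ (shiftAut_aut h1 b) (shiftAut_one _ _)
    rw [shiftAut_apply, hb φ h1 h2] at this
    exact mul_inv_eq_iff_eq_mul.1 this
  inv_mem' := by
    intro a ha φ h1 h2
    have := ha _ (shiftAut_aut h1 a⁻¹) (shiftAut_one _ _)
    rw [shiftAut_apply, mul_inv_cancel, h2, one_mul] at this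
    exact inv_eq_iff_eq_inv.1 this

lemma mem_fix {S : Set G} {x : G} : x ∈ FixSub S ↔
    ∀ φ : Equiv.Perm G, IsCayleyAut S φ → φ 1 = 1 → φ x = x := Iff.rfl

lemma orr_of_fix {S : Set G} (hS : ∀ s ∈ S, s⁻¹ ∉ S) (h : FixSub S = ⊤) : HasORR G := by
  refine ⟨S, ?_, ?_⟩
  · ext x
    simp only [Set.mem_inter_iff, Set.mem_inv, Set.mem_empty_iff_false, iff_false, not_and]
    exact hS x
  · intro φ hφ
    refine ⟨φ 1, fun v => ?_⟩
    have hv : v ∈ FixSub S := by rw [h]; trivial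
    have := hv _ (shiftAut_aut hφ 1) (shiftAut_one _ _)
    rw [shiftAut_apply, mul_one] at this
    exact mul_inv_eq_iff_eq_mul.1 this

lemma orr_of_closure {S T : Set G} (hS : ∀ s ∈ S, s⁻¹ ∉ S) (hT : Subgroup.closure T = ⊤)
    (h : ∀ t ∈ T, t ∈ FixSub S) : HasORR G := by
  apply orr_of_fix hS
  rw [eq_top_iff, ← hT, Subgroup.closure_le]
  exact h

lemma aut_mem {S : Set G} {φ : Equiv.Perm G} (h : IsCayleyAut S φ) (h1 : φ 1 = 1) (u : G) :
    φ u ∈ S ↔ u ∈ S := by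
  have := h 1 u
  rw [h1] at this
  simpa using this.symm

/-- A predicate `F` closed under the unique element with an invariant property. -/
def UClosed {V : Type*} (R : V → V → Prop) (D : V → Prop) (F : V → Prop) : Prop :=
  ∀ P : V → Prop, (∀ ψ : Equiv.Perm V, (∀ a b, R (ψ a) (ψ b) ↔ R a b) →
    (∀ a, D (ψ a) ↔ D a) → (∀ a, F a → ψ a = a) → ∀ w, P w → P (ψ w)) →
    ∀ x, P x → (∀ w, P w → w = x ∨ F w) → F x

lemma uclosed_fix {V : Type*} {S : Set G} (val : V → G) {D : V → Prop} {R : V → V → Prop}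
    (inj : ∀ a b, D a → D b → val a = val b → a = b)
    (hS : ∀ g, g ∈ S ↔ ∃ a, D a ∧ val a = g)
    (hR : ∀ a b, R a b ↔ D a ∧ D b ∧ val b * (val a)⁻¹ ∈ S) :
    UClosed R D (fun a => D a → val a ∈ FixSub S) := by
  classical
  intro P hP a hPa hu ha φ h1 h2
  have key : ∀ φ : Equiv.Perm G, IsCayleyAut S φ → φ 1 = 1 → ∀ a : Subtype D,
      ∃ b : Subtype D, val b = φ (val a) := by
    intro φ h1 h2 a
    have : φ (val a) ∈ S := (aut_mem h1 h2 _).2 ((hS _).2 ⟨a, a.2, rfl⟩)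
    obtain ⟨b, hb, hb'⟩ := (hS _).1 this
    exact ⟨⟨b, hb⟩, hb'⟩
  have h3 : IsCayleyAut S φ.symm := by
    intro x y
    rw [h1 (φ.symm x) (φ.symm y)]
    simp
  have h4 : φ.symm 1 = 1 := by rw [Equiv.symm_apply_eq, h2]
  choose f hf using key φ h1 h2
  choose f' hf' using key φ.symm h3 h4
  let ψ : Equiv.Perm (Subtype D) := ⟨f, f', by
    intro a
    apply Subtype.ext
    apply inj _ _ (Subtype.prop _) (Subtype.prop _)
    rw [hf', hf]; simp, by
    intro a
    apply Subtype.ext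
    apply inj _ _ (Subtype.prop _) (Subtype.prop _)
    rw [hf, hf']; simp⟩
  have hψ : ∀ a, val (Equiv.Perm.ofSubtype ψ a) = φ (val a) ∨ ¬ D a := by
    intro a
    by_cases ha : D a
    · left
      rw [Equiv.Perm.ofSubtype_apply_of_mem _ ha]
      exact hf ⟨a, ha⟩
    · right; exact ha
  have hD : ∀ a, D (Equiv.Perm.ofSubtype ψ a) ↔ D a := by
    intro a
    exact Equiv.Perm.ofSubtype_apply_mem_iff_mem ψ a
  have hfix := hP (Equiv.Perm.ofSubtype ψ) (by
    intro a b
    rw [hR, hR, hD, hD]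
    constructor
    · rintro ⟨ha, hb, hab⟩
      refine ⟨ha, hb, ?_⟩
      rwa [(hψ a).resolve_right (not_not.2 ha), (hψ b).resolve_right (not_not.2 hb), ← h1] at hab
    · rintro ⟨ha, hb, hab⟩
      refine ⟨ha, hb, ?_⟩
      rwa [(hψ a).resolve_right (not_not.2 ha), (hψ b).resolve_right (not_not.2 hb), ← h1]) hD (by
    intro a ha
    by_cases hDa : D a
    · apply inj _ _ ((hD a).2 hDa) hDa
      rw [(hψ a).resolve_right (not_not.2 hDa)]
      exact ha hDa φ h1 h2
    · exact Equiv.Perm.ofSubtype_apply_of_not_mem ψ hDa) a hPa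
  have := (hψ a).resolve_right (not_not.2 ha)
  rcases hu _ hfix with h | h
  · rw [← this, h]
  · have h5 := h ((hD a).2 ha) φ h1 h2
    rw [this] at h5
    exact φ.injective h5

section pinned
variable {V : Type*} {R : V → V → Prop} {D F : V → Prop}

/-- Uniqueness for predicates defined in terms of the relation. -/
lemma pin_of_rel (hF : UClosed R D F) (P : (V → V → Prop) → V → Prop)
    (hP : ∀ (ψ : Equiv.Perm V) (R : V → V → Prop) (w : V),
      P (fun u v => R (ψ u) (ψ v)) w → P R (ψ w)) {x : V}
    (hx : P R x) (hu : ∀ w, P R w → w = x ∨ F w) : F x := by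
  apply hF (P R) _ _ hx hu
  intro ψ h1 h2 _ w hw
  apply hP
  have : (fun u v => R (ψ u) (ψ v)) = R := by
    funext u v
    exact propext (h1 u v)
  rwa [this]

lemma pin_out (hF : UClosed R D F) {u v : V} (hu : F u) (h : R u v)
    (h' : ∀ w, R u w → w = v ∨ F w) : F v := by
  apply hF (fun w => R u w) _ _ h h'
  intro φ h1 h2 h3 w hw
  have := (h1 u w).2 hw
  rwa [h3 _ hu] at this

lemma pin_in (hF : UClosed R D F) {u v : V} (hu : F u) (h : R v u)
    (h' : ∀ w, R w u → w = v ∨ F w) : F v := by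
  apply hF (fun w => R w u) _ _ h h'
  intro φ h1 h2 h3 w hw
  have := (h1 w u).2 hw
  rwa [h3 _ hu] at this

lemma pin_last (hF : UClosed R D F) {v : V} (h : D v)
    (h' : ∀ w, D w → w = v ∨ F w) : F v := by
  apply hF (fun w => D w) _ _ h h'
  intro φ h1 h2 _ w hw
  exact (h2 w).2 hw

lemma pin_out_sink (hF : UClosed R D F) {u v : V} (hu : F u) (h : R u v) (hv : ∀ w, ¬ R v w)
    (h' : ∀ w, R u w → (∀ r, ¬ R w r) → w = v ∨ F w) : F v := by
  apply hF (fun w => R u w ∧ ∀ r, ¬ R w r) _ _ ⟨h, hv⟩ (fun w hw => h' w hw.1 hw.2)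
  rintro φ h1 h2 h3 w ⟨hw, hw'⟩
  constructor
  · have := (h1 u w).2 hw
    rwa [h3 _ hu] at this
  · intro r hr
    apply hw' (φ.symm r)
    rw [← h1, φ.apply_symm_apply]
    exact hr

lemma pin_in_source (hF : UClosed R D F) {u v : V} (hu : F u) (h : R v u) (hv : ∀ w, ¬ R w v)
    (h' : ∀ w, R w u → (∀ r, ¬ R r w) → w = v ∨ F w) : F v := by
  apply hF (fun w => R w u ∧ ∀ r, ¬ R r w) _ _ ⟨h, hv⟩ (fun w hw => h' w hw.1 hw.2)
  rintro φ h1 h2 h3 w ⟨hw, hw'⟩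
  constructor
  · have := (h1 w u).2 hw
    rwa [h3 _ hu] at this
  · intro r hr
    apply hw' (φ.symm r)
    rw [← h1, φ.apply_symm_apply]
    exact hr

end pinned

/-- transfer along isomorphisms -/
lemma orr_transfer {H : Type*} [Group H] (e : G ≃* H) (h : HasORR G) : HasORR H := by
  obtain ⟨S, hS, hd⟩ := h
  refine ⟨e.symm ⁻¹' S, ?_, ?_⟩
  · ext x
    simp only [Set.mem_inter_iff, Set.mem_inv, Set.mem_empty_iff_false, iff_false, not_and,
      Set.mem_preimage, map_inv]
    intro h1 h2
    have : e.symm x ∈ S ∩ S⁻¹ := ⟨h1, h2⟩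
    rw [hS] at this
    exact this
  · intro φ hφ
    obtain ⟨g, hg⟩ := hd ((e.toEquiv.trans φ).trans e.symm.toEquiv) (by
      intro x y
      have := hφ (e x) (e y)
      simp only [Set.mem_preimage, map_mul, map_inv, MulEquiv.symm_apply_apply] at this
      simpa using this)
    refine ⟨e g, fun v => ?_⟩
    have := hg (e.symm v)
    simp only [Equiv.trans_apply] at this
    have h2 := congrArg e this
    simpa using h2

end ORR


namespace ORR

/-- Formal names of the elements of a path set. -/
inductive V : Type
  | X (i : ℕ) : V
  | H (k : ℕ) : V

open V

/-- Validity of names. -/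
def DV (d m : ℕ) : V → Prop
  | X i => i < d
  | H k => m ≤ k ∧ k + 1 < d

/-- The arc relation on names. -/
def RV (d m : ℕ) (tl hd : ℕ → ℕ) (A B C : ℕ → Prop) : V → V → Prop
  | X i, X j => ∃ k, m ≤ k ∧ k + 1 < d ∧ i = tl k ∧ j = hd k
  | X i, H k => m ≤ k ∧ k + 1 < d ∧ A k ∧ i = hd k
  | H k, X i => m ≤ k ∧ k + 1 < d ∧ ((B k ∧ i = hd k) ∨ (C k ∧ i = tl k))
  | H _, H _ => False

/-- The standard orientation. -/
def RP (d m : ℕ) (A B C : ℕ → Prop) : V → V → Prop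
  | X i, X j => m ≤ i ∧ j < d ∧ j = i + 1
  | X i, H k => m ≤ k ∧ k + 1 < d ∧ A k ∧ i = k + 1
  | H k, X i => m ≤ k ∧ k + 1 < d ∧ ((B k ∧ i = k + 1) ∨ (C k ∧ i = k))
  | H _, H _ => False

/-- The orientation with the first edge reversed. -/
def RM (d : ℕ) (A B C : ℕ → Prop) : V → V → Prop
  | X i, X j => (i = 1 ∧ j = 0) ∨ (1 ≤ i ∧ j < d ∧ j = i + 1)
  | X i, H k => k + 1 < d ∧ A k ∧ ((k = 0 ∧ i = 0) ∨ (1 ≤ k ∧ i = k + 1))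
  | H k, X i => k + 1 < d ∧ ((B k ∧ ((k = 0 ∧ i = 0) ∨ (1 ≤ k ∧ i = k + 1))) ∨
      (C k ∧ ((k = 0 ∧ i = 1) ∨ (1 ≤ k ∧ i = k))))
  | H _, H _ => False

lemma RV_eq_RP (d m : ℕ) (A B C : ℕ → Prop) :
    RV d m (fun k => k) (fun k => k + 1) A B C = RP d m A B C := by
  funext a b
  apply propext
  cases a <;> cases b <;> simp only [RV, RP]
  constructor
  · rintro ⟨k, h1, h2, rfl, rfl⟩; omega
  · rintro ⟨h1, h2, rfl⟩; exact ⟨_, h1, h2, rfl, rfl⟩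

lemma RV_eq_RM (d : ℕ) (hd : 2 ≤ d) (A B C : ℕ → Prop) :
    RV d 0 (fun k => if k = 0 then 1 else k) (fun k => if k = 0 then 0 else k + 1) A B C
      = RM d A B C := by
  funext a b
  apply propext
  cases a with
  | X i =>
    cases b with
    | X j =>
      simp only [RV, RM]
      constructor
      · rintro ⟨k, h1, h2, h3, h4⟩
        split_ifs at h3 h4 <;> omega
      · rintro (⟨h1, h2⟩ | ⟨h1, h2, h3⟩)
        · exact ⟨0, by omega, by omega, by simpa using h1, by simpa using h2⟩
        · exact ⟨i, by omega, by omega, by rw [if_neg (by omega)], by rw [if_neg (by omega)]; exact h3⟩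
    | H k =>
      simp only [RV, RM]
      rcases Nat.eq_zero_or_pos k with rfl | h
      · simp
      · rw [if_neg (by omega)]
        constructor
        · rintro ⟨h1, h2, h3, h4⟩; exact ⟨h2, h3, by omega⟩
        · rintro ⟨h2, h3, h4⟩; exact ⟨by omega, h2, h3, by omega⟩
  | H k =>
    cases b with
    | X i =>
      simp only [RV, RM]
      rcases Nat.eq_zero_or_pos k with rfl | h
      · simp
      · rw [if_neg (by omega), if_neg (by omega)]
        have e1 : ((k = 0 ∧ i = 0) ∨ (1 ≤ k ∧ i = k + 1)) ↔ i = k + 1 := by omega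
        have e2 : ((k = 0 ∧ i = 1) ∨ (1 ≤ k ∧ i = k)) ↔ i = k := by omega
        rw [e1, e2]
        simp
    | H k => simp only [RV, RM]

section plus
variable {d m : ℕ} {A B C : ℕ → Prop} {F : V → Prop}

lemma chainP (hF : UClosed (RP d m A B C) (DV d m) F)
    (hH : ∀ k, m ≤ k → k + 1 < d → F (X k) → F (X (k + 1)) → F (H k))
    (s : ℕ) (hs : m ≤ s) (hs2 : s = m ∨ ¬ A (s - 1)) (h : F (X s)) :
    ∀ i, s ≤ i → i < d → F (X i) := by
  intro i
  induction i using Nat.strong_induction_on with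
  | _ i ih =>
    intro h1 h2
    rcases Nat.eq_or_lt_of_le h1 with rfl | h3
    · exact h
    · apply pin_out hF (ih (i - 1) (by omega) (by omega) (by omega))
      · unfold RP; omega
      · rintro (j | k) hw
        · simp only [RP] at hw
          left; congr 1; omega
        · simp only [RP] at hw
          obtain ⟨k1, k2, k3, k4⟩ := hw
          right
          have hk : s ≤ k := by
            by_contra hcon
            have : k = s - 1 := by omega
            rcases hs2 with hs2 | hs2
            · omega
            · rw [this] at k3; exact hs2 k3
          exact hH k k1 k2 (ih k (by omega) hk (by omega)) (ih (k+1) (by omega) (by omega) (by omega))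

/-- first uniqueness predicate -/
def Pr1 (R : V → V → Prop) (w : V) : Prop :=
  (∃ q, R q w ∧ ∀ p, ¬ R p q) ∧ ∀ q, R q w → ∀ p, R p q → R w p

lemma Pr1_inv (ψ : Equiv.Perm V) (R : V → V → Prop) (w : V)
    (h : Pr1 (fun u v => R (ψ u) (ψ v)) w) : Pr1 R (ψ w) := by
  obtain ⟨⟨q, hq, hs⟩, h⟩ := h
  refine ⟨⟨ψ q, hq, fun p hp => hs (ψ.symm p) (by simpa using hp)⟩, fun q hq p hp => ?_⟩
  have := h (ψ.symm q) (by simpa using hq) (ψ.symm p) (by simpa using hp)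
  simpa using this

/-- second uniqueness predicate -/
def Pr2 (R : V → V → Prop) (w : V) : Prop :=
  ∃ v, R v w ∧ (∀ v', R v' w → v' = v) ∧ ∀ u, ¬ R u v

lemma Pr2_inv (ψ : Equiv.Perm V) (R : V → V → Prop) (w : V)
    (h : Pr2 (fun u v => R (ψ u) (ψ v)) w) : Pr2 R (ψ w) := by
  obtain ⟨v, hv, h, hs⟩ := h
  refine ⟨ψ v, hv, fun q hq => ?_, fun u hu => hs (ψ.symm u) (by simpa using hu)⟩
  rw [← h (ψ.symm q) (by simpa using hq)]; simp

lemma pr1P (hF : UClosed (RP d m A B C) (DV d m) F) (hm : m + 1 < d) (hB : ¬ B m) (hC : ¬ C m) :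
    F (X (m + 1)) := by
  apply pin_of_rel hF Pr1 Pr1_inv
  · refine ⟨⟨X m, ?_, ?_⟩, ?_⟩
    · unfold RP; omega
    · rintro (j | k) h
      · simp only [RP] at h; omega
      · simp only [RP] at h
        obtain ⟨k1, k2, ⟨k3, k4⟩ | ⟨k3, k4⟩⟩ := h
        · omega
        · subst k4; exact hC k3
    · rintro (j | k) hq (p | l) hp
      · simp only [RP] at hq hp; omega
      · simp only [RP] at hq hp
        obtain ⟨k1, k2, ⟨k3, k4⟩ | ⟨k3, k4⟩⟩ := hp
        · omega
        · have : l = m := by omega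
          subst this; exact absurd k3 hC
      · simp only [RP] at hq hp ⊢
        obtain ⟨k1, k2, ⟨k3, k4⟩ | ⟨k3, k4⟩⟩ := hq
        · have : k = m := by omega
          subst this; exact absurd k3 hB
        · omega
      · simp only [RP] at hp
  · rintro (i | k) ⟨⟨q, hq, hs⟩, h⟩
    · left; congr 1
      rcases q with j | k
      · simp only [RP] at hq
        by_contra hne
        apply hs (X (j - 1))
        unfold RP; omega
      · simp only [RP] at hq
        obtain ⟨k1, k2, ⟨k3, k4⟩ | ⟨k3, k4⟩⟩ := hq
        · have hk : k ≠ m := by rintro rfl; exact hB k3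
          have := h (X k) (by unfold RP; omega) (X (k - 1)) (by unfold RP; omega)
          simp only [RP] at this; omega
        · have hk : k ≠ m := by rintro rfl; exact hC k3
          by_contra hne
          have := h (X (k-1)) (by unfold RP; omega) (X (k - 2)) (by unfold RP; omega)
          simp only [RP] at this; omega
    · exfalso
      rcases q with j | k
      · simp only [RP] at hq
        apply hs (X (j - 1))
        unfold RP; omega
      · simp only [RP] at hq

lemma pr2P (hF : UClosed (RP d m A B C) (DV d m) F) (hm : m + 1 < d) (hA : ¬ A m) (hC : C m) :
    F (X m) := by
  apply pin_of_rel hF Pr2 Pr2_inv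
  · refine ⟨H m, ?_, ?_, ?_⟩
    · unfold RP; exact ⟨le_rfl, hm, Or.inr ⟨hC, rfl⟩⟩
    · rintro (j | k) h
      · simp only [RP] at h; omega
      · simp only [RP] at h
        congr 1; omega
    · rintro (j | k) h
      · simp only [RP] at h; exact hA h.2.2.1
      · simp only [RP] at h
  · rintro (i | k) ⟨v, hv, hu, hs⟩
    · left; congr 1
      by_contra hne
      have him : m < i ∧ i < d := by
        rcases v with j | k
        · simp only [RP] at hv; omega
        · simp only [RP] at hv; omega
      have h1 := hu (X (i - 1)) (by unfold RP; omega)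
      rw [← h1] at hs
      by_cases h2 : i = m + 1
      · apply hs (H m)
        unfold RP; exact ⟨le_rfl, hm, Or.inr ⟨hC, by omega⟩⟩
      · apply hs (X (i - 2))
        unfold RP; omega
    · exfalso
      rcases v with j | l
      · simp only [RP] at hv
        apply hs (X k)
        unfold RP; omega
      · simp only [RP] at hv

lemma goodP (hF : UClosed (RP d m A B C) (DV d m) F)
    (hH : ∀ k, m ≤ k → k + 1 < d → F (X k) → F (X (k + 1)) → F (H k))
    (hm : m + 1 < d) (hB : ¬ B m) (hAC : ¬ (A m ∧ C m))
    (hside : m + 2 < d → A m → C (m + 1) → A (m + 1)) :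
    ∀ i, m ≤ i → i < d → F (X i) := by
  by_cases hC : C m
  · exact chainP hF hH m le_rfl (Or.inl rfl) (pr2P hF hm (fun h => hAC ⟨h, hC⟩) hC)
  have h1 := pr1P hF hm hB hC
  by_cases hA : A m
  · apply chainP hF hH m le_rfl (Or.inl rfl)
    apply pin_in_source hF h1
    · unfold RP; omega
    · rintro (j | k) h
      · simp only [RP] at h; omega
      · simp only [RP] at h
        obtain ⟨k1, k2, ⟨k3, k4⟩ | ⟨k3, k4⟩⟩ := h
        · omega
        · subst k4; exact hC k3
    · rintro (j | k) h hs
      · simp only [RP] at h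
        left; congr 1; omega
      · exfalso
        simp only [RP] at h
        obtain ⟨k1, k2, ⟨k3, k4⟩ | ⟨k3, k4⟩⟩ := h
        · have : k = m := by omega
          subst this; exact hB k3
        · subst k4
          apply hs (X (m + 2))
          unfold RP
          exact ⟨by omega, by omega, hside (by omega) hA k3, rfl⟩
  · have h2 := chainP hF hH (m + 1) (by omega) (Or.inr hA) h1
    intro i hi hid
    rcases Nat.eq_or_lt_of_le hi with rfl | h3
    · apply pin_in hF h1
      · unfold RP; omega
      · rintro (j | k) h
        · simp only [RP] at h
          left; congr 1; omega
        · right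
          simp only [RP] at h
          obtain ⟨k1, k2, ⟨k3, k4⟩ | ⟨k3, k4⟩⟩ := h
          · have : k = m := by omega
            subst this; exact absurd k3 hB
          · subst k4
            exact hH _ k1 k2 h1 (h2 _ (by omega) (by omega))
    · exact h2 i h3 hid

/-- third uniqueness predicate -/
def PrW (R : V → V → Prop) (w : V) : Prop :=
  ∃ p q, (∀ r, R r w ↔ r = q) ∧ (∀ r, R r q ↔ r = p) ∧ (∀ r, R w r ↔ r = p) ∧
    (∀ r, R q r ↔ r = w) ∧ ∀ r, R r p → r ≠ w → ∀ s, R s r → R p s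

lemma PrW_inv (ψ : Equiv.Perm V) (R : V → V → Prop) (w : V)
    (h : PrW (fun u v => R (ψ u) (ψ v)) w) : PrW R (ψ w) := by
  obtain ⟨p, q, h1, h2, h3, h4, h5⟩ := h
  refine ⟨ψ p, ψ q, fun r => ?_, fun r => ?_, fun r => ?_, fun r => ?_, fun r hr hrw s hs => ?_⟩
  · have := h1 (ψ.symm r); rw [Equiv.symm_apply_eq] at this; simpa using this
  · have := h2 (ψ.symm r); rw [Equiv.symm_apply_eq] at this; simpa using this
  · have := h3 (ψ.symm r); rw [Equiv.symm_apply_eq] at this; simpa using this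
  · have := h4 (ψ.symm r); rw [Equiv.symm_apply_eq] at this; simpa using this
  · have := h5 (ψ.symm r) (by simpa using hr) (by rwa [Ne, Equiv.symm_apply_eq])
      (ψ.symm s) (by simpa using hs)
    simpa using this

lemma quatP {d : ℕ} (hF : UClosed (RP d 0 A B C) (DV d 0) F)
    (hH : ∀ k, 0 ≤ k → k + 1 < d → F (X k) → F (X (k + 1)) → F (H k))
    (hd : 4 ≤ d) (hB : ¬ B 0) (hA : A 0) (hC : C 0) :
    ∀ i, i < d → F (X i) := by
  intro i hi
  refine chainP hF hH 0 le_rfl (Or.inl rfl) ?_ i (Nat.zero_le _) hi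
  apply pin_of_rel hF PrW PrW_inv
  · refine ⟨X 1, H 0, ?_, ?_, ?_, ?_, ?_⟩
    · rintro (j | k)
      · simp [RP]
      · simp only [RP, V.H.injEq]
        constructor
        · intro h; omega
        · rintro rfl; exact ⟨le_rfl, by omega, Or.inr ⟨hC, rfl⟩⟩
    · rintro (j | k)
      · simp only [RP, V.X.injEq]
        constructor
        · intro h; omega
        · rintro rfl; exact ⟨le_rfl, by omega, hA, rfl⟩
      · simp [RP]
    · rintro (j | k)
      · simp only [RP, V.X.injEq]; omega
      · simp [RP]
    · rintro (j | k)
      · simp only [RP, V.X.injEq]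
        constructor
        · rintro ⟨k1, k2, ⟨k3, k4⟩ | ⟨k3, k4⟩⟩
          · exact absurd k3 hB
          · exact k4
        · rintro rfl; exact ⟨le_rfl, by omega, Or.inr ⟨hC, rfl⟩⟩
      · simp [RP]
    · rintro (j | k) h hne s hs
      · simp only [RP] at h
        exact absurd (congrArg X (by omega : j = 0)) hne
      · simp only [RP] at h
        obtain ⟨k1, k2, ⟨k3, k4⟩ | ⟨k3, k4⟩⟩ := h
        · have : k = 0 := by omega
          subst this; exact absurd k3 hB
        · subst k4
          rcases s with s | s
          · simp only [RP] at hs ⊢; omega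
          · simp only [RP] at hs
  · rintro (i | k) ⟨p, q, h1, h2, h3, h4, h5⟩
    · left; congr 1
      by_contra hi0
      have hid : i < d := by
        have := (h1 q).2 rfl
        rcases q with j | k <;> simp only [RP] at this <;> omega
      have hq := (h1 (X (i - 1))).1 (by unfold RP; omega)
      subst hq
      rcases Nat.lt_or_ge i 2 with h | h
      · have : i = 1 := by omega
        subst this
        have e1 := (h3 (X 2)).1 (by unfold RP; omega)
        have e2 := (h3 (H 0)).1 (by unfold RP; exact ⟨le_rfl, by omega, hA, rfl⟩)
        rw [← e1] at e2
        cases e2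
      · have hp := (h2 (X (i - 2))).1 (by unfold RP; omega)
        subst hp
        have := (h3 (X (i - 2))).2 rfl
        simp only [RP] at this; omega
    · exfalso
      have hq := (h1 q).2 rfl
      rcases q with j | l
      · simp only [RP] at hq
        obtain ⟨k1, k2, k3, rfl⟩ := hq
        have hk : k + 2 = d := by
          by_contra hne
          have := (h4 (X (k + 2))).1 (by unfold RP; omega)
          cases this
        have hp := (h2 (X k)).1 (by unfold RP; omega)
        subst hp
        have := h5 (X (k - 1)) (by unfold RP; omega) (by intro h; cases h)
          (X (k - 2)) (by unfold RP; omega)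
        simp only [RP] at this; omega
      · simp only [RP] at hq

end plus

section minus
variable {d : ℕ} {A B C : ℕ → Prop} {F : V → Prop}

/-- fourth uniqueness predicate -/
def PrY (R : V → V → Prop) (v : V) : Prop :=
  (∃ u w, R v u ∧ (∀ r, ¬ R u r) ∧ R v w ∧ (∃ r, R w r) ∧ ¬ R w u) ∧
  (∀ q, R q v → ∀ p, R p q → R v p) ∧ (∀ q, R q v → ∀ r, R q r → r = v ∨ R v r)

lemma PrY_inv (ψ : Equiv.Perm V) (R : V → V → Prop) (w : V)
    (h : PrY (fun u v => R (ψ u) (ψ v)) w) : PrY R (ψ w) := by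
  obtain ⟨⟨u, v, h1, h2, h3, ⟨r, hr⟩, h4⟩, h5, h6⟩ := h
  refine ⟨⟨ψ u, ψ v, h1, fun r hr => h2 (ψ.symm r) (by simpa using hr), h3, ⟨ψ r, hr⟩, h4⟩, ?_, ?_⟩
  · intro q hq p hp
    have := h5 (ψ.symm q) (by simpa using hq) (ψ.symm p) (by simpa using hp)
    simpa using this
  · intro q hq r hr
    have := h6 (ψ.symm q) (by simpa using hq) (ψ.symm r) (by simpa using hr)
    rw [Equiv.symm_apply_eq] at this
    simpa using this

lemma commM (hF : UClosed (RM d A B C) (DV d 0) F)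
    (hH : ∀ k, 0 ≤ k → k + 1 < d → F (X k) → F (X (k + 1)) → F (H k))
    (hd : 4 ≤ d) (hA : ¬ A 0) :
    ∀ i, i < d → F (X i) := by
  have hsink : ∀ r, ¬ RM d A B C (X 0) r := by
    rintro (j | k) h
    · simp only [RM] at h; omega
    · simp only [RM] at h
      obtain ⟨k1, k2, k3⟩ := h
      have : k = 0 := by omega
      subst this; exact hA k2
  have h1 : F (X 1) := by
    apply pin_of_rel hF PrY PrY_inv
    · refine ⟨⟨X 0, X 2, ?_, hsink, ?_, ⟨X 3, ?_⟩, ?_⟩, ?_, ?_⟩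
      · unfold RM; omega
      · unfold RM; omega
      · unfold RM; omega
      · unfold RM; omega
      · rintro (j | k) hq p hp
        · simp only [RM] at hq; omega
        · rcases p with i | l
          · simp only [RM] at hq hp ⊢
            obtain ⟨k1, ⟨k2, k3⟩ | ⟨k2, k3⟩⟩ := hq
            · omega
            · obtain ⟨k4, k5, k6⟩ := hp
              rcases k3 with ⟨rfl, -⟩ | ⟨k7, k8⟩
              · exact absurd k5 hA
              · omega
          · simp only [RM] at hp
      · rintro (j | k) hq r hr
        · simp only [RM] at hq; omega
        · rcases r with i | l
          · simp only [RM] at hq hr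
            unfold RM
            rw [V.X.injEq]
            obtain ⟨k1, ⟨-, k3⟩ | ⟨-, k3⟩⟩ := hq <;> obtain ⟨-, ⟨-, k5⟩ | ⟨-, k5⟩⟩ := hr <;> omega
          · simp only [RM] at hr
    · rintro (i | k) ⟨⟨u, w, h1, h2, h3, ⟨r, hr⟩, h4⟩, h5, h6⟩
      · left; congr 1
        by_contra hi
        have hi0 : i ≠ 0 := by rintro rfl; exact hsink _ h1
        have hid : i < d := by
          rcases u with u | u <;> simp only [RM] at h1 <;> omega
        have hq : RM d A B C (X (i - 1)) (X i) := by unfold RM; omega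
        rcases Nat.lt_or_ge i 3 with h | h
        · have : i = 2 := by omega
          subst this
          have := h6 (X 1) hq (X 0) (by unfold RM; omega)
          simp only [RM, V.X.injEq] at this; omega
        · have := h5 (X (i - 1)) hq (X (i - 2)) (by unfold RM; omega)
          simp only [RM] at this; omega
      · exfalso
        rcases u with u | u
        · rcases w with w | w
          · simp only [RM] at h1 h3 h4
            have huw : u ≠ w := by rintro rfl; exact h2 _ hr
            rcases Nat.eq_zero_or_pos k with rfl | hk
            · rcases Nat.eq_zero_or_pos u with rfl | hu
              · omega
              · have : u = 1 := by omega
                subst this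
                apply h2 (X 0); unfold RM; omega
            · by_cases hu : u = k
              · apply h2 (X (k + 1)); unfold RM; omega
              · omega
          · simp only [RM] at h3
        · simp only [RM] at h1
  have h0 : F (X 0) := by
    apply pin_out_sink hF h1
    · unfold RM; omega
    · exact hsink
    · rintro (i | k) h hs
      · simp only [RM] at h
        left; congr 1
        by_contra hi
        have : i = 2 := by omega
        subst this
        apply hs (X 3); unfold RM; omega
      · simp only [RM] at h; omega
  have h2 : F (X 2) := by
    apply pin_out hF h1
    · unfold RM; omega
    · rintro (i | k) h
      · simp only [RM] at h
        by_cases hi : i = 0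
        · subst hi; right; exact h0
        · left; congr 1; omega
      · simp only [RM] at h; omega
  intro i
  induction i using Nat.strong_induction_on with
  | _ i ih =>
    intro hi
    rcases Nat.lt_or_ge i 3 with h | h
    · interval_cases i
      · exact h0
      · exact h1
      · exact h2
    · apply pin_out hF (ih (i - 1) (by omega) (by omega))
      · unfold RM; omega
      · rintro (j | k) hw
        · simp only [RM] at hw
          left; congr 1; omega
        · simp only [RM] at hw
          obtain ⟨k1, k2, k3⟩ := hw
          right
          exact hH k (by omega) k1 (ih k (by omega) (by omega)) (ih (k+1) (by omega) (by omega))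

end minus

end ORR


namespace ORR

variable {G : Type*} [Group G]

open V

/-- Values of names. -/
def pval (x : ℕ → G) (tl hd : ℕ → ℕ) : V → G
  | X i => x i
  | H k => x (hd k) * (x (tl k))⁻¹

/-- Hypotheses on a tuple used for the path set. -/
structure PD (x : ℕ → G) (d m : ℕ) (tl hd : ℕ → ℕ) : Prop where
  ori : ∀ k, (tl k = k ∧ hd k = k + 1) ∨ (tl k = k + 1 ∧ hd k = k)
  irr : ∀ i < d, x i ∉ Subgroup.closure {g | ∃ j < d, j ≠ i ∧ x j = g}
  sq : ∀ i < d, x i * x i ≠ 1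
  hsq : ∀ k, m ≤ k → k + 1 < d →
    (x (hd k) * (x (tl k))⁻¹) * (x (hd k) * (x (tl k))⁻¹) ≠ 1

/-- The path set. -/
def pset (x : ℕ → G) (d m : ℕ) (tl hd : ℕ → ℕ) : Set G :=
  {g | ∃ a, DV d m a ∧ pval x tl hd a = g}

/-- Condition A. -/
def cA (x : ℕ → G) (tl hd : ℕ → ℕ) (k : ℕ) : Prop := x (tl k) * x (hd k) = x (hd k) * (x (tl k))⁻¹
/-- Condition B. -/
def cB (x : ℕ → G) (tl hd : ℕ → ℕ) (k : ℕ) : Prop := x (tl k) * x (hd k) = x (hd k) * x (tl k)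
/-- Condition C. -/
def cC (x : ℕ → G) (tl hd : ℕ → ℕ) (k : ℕ) : Prop :=
  x (tl k) * x (tl k) = x (hd k) * x (hd k) ∨
  (x (hd k) * (x (tl k))⁻¹) * (x (hd k) * (x (tl k))⁻¹) = x (tl k)

/-- Support of a name. -/
def supp : V → ℕ → Prop
  | X i, j => j = i
  | H k, j => j = k ∨ j = k + 1

section
variable {x : ℕ → G} {d m : ℕ} {tl hd : ℕ → ℕ}

lemma mem_M (h : PD x d m tl hd) {a : V} (ha : DV d m a) {i : ℕ} (hi : i < d) :
    pval x tl hd a ∈ Subgroup.closure {g | ∃ j < d, j ≠ i ∧ x j = g} ↔ ¬ supp a i := by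
  have hx : ∀ j, j < d → j ≠ i → x j ∈ Subgroup.closure {g | ∃ j < d, j ≠ i ∧ x j = g} :=
    fun j h1 h2 => Subgroup.subset_closure ⟨j, h1, h2, rfl⟩
  cases a with
  | X j =>
    simp only [pval, supp, DV] at *
    constructor
    · rintro h1 rfl
      exact h.irr _ hi h1
    · intro h1
      exact hx _ ha (Ne.symm h1)
  | H k =>
    simp only [pval, supp, DV] at *
    constructor
    · rintro h1 h2
      have hn := h.irr _ hi
      rcases h.ori k with ⟨e1, e2⟩ | ⟨e1, e2⟩ <;> rw [e1, e2] at h1 <;> rcases h2 with h2 | h2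
      · rw [h2] at hn hx h1
        have := (Subgroup.mul_mem_cancel_left _ (hx (k + 1) (by omega) (by omega))).1 h1
        exact hn (by simpa using this)
      · rw [h2] at hn hx h1
        have := (Subgroup.mul_mem_cancel_right _
          (Subgroup.inv_mem _ (hx k (by omega) (by omega)))).1 h1
        exact hn this
      · rw [h2] at hn hx h1
        have := (Subgroup.mul_mem_cancel_right _
          (Subgroup.inv_mem _ (hx (k + 1) (by omega) (by omega)))).1 h1
        exact hn this
      · rw [h2] at hn hx h1
        have := (Subgroup.mul_mem_cancel_left _ (hx k (by omega) (by omega))).1 h1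
        exact hn (by simpa using this)
    · intro h1
      apply Subgroup.mul_mem
      · rcases h.ori k with ⟨e1, e2⟩ | ⟨e1, e2⟩ <;> rw [e2] <;> apply hx <;> omega
      · apply Subgroup.inv_mem
        rcases h.ori k with ⟨e1, e2⟩ | ⟨e1, e2⟩ <;> rw [e1] <;> apply hx <;> omega

lemma supp_lt {a : V} (ha : DV d m a) {j : ℕ} (hj : supp a j) : j < d := by
  cases a <;> simp only [DV, supp] at * <;> omega

lemma supp_eq (h : PD x d m tl hd) {a b : V} (ha : DV d m a) (hb : DV d m b)
    (hab : ∀ M : Subgroup G, pval x tl hd a ∈ M ↔ pval x tl hd b ∈ M) : a = b := by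
  have key : ∀ j, supp a j ↔ supp b j := by
    intro j
    constructor
    · intro hj
      by_contra hc
      exact (mem_M h ha (supp_lt ha hj)).1
        ((hab _).2 ((mem_M h hb (supp_lt ha hj)).2 hc)) hj
    · intro hj
      by_contra hc
      exact (mem_M h hb (supp_lt hb hj)).1
        ((hab _).1 ((mem_M h ha (supp_lt hb hj)).2 hc)) hj
  cases a with
  | X i =>
    cases b with
    | X j => have := key i; unfold supp at this; congr 1; omega
    | H k =>
      have h1 := key k; have h2 := key (k + 1)
      unfold supp at h1 h2; omega
  | H k =>
    cases b with
    | X j =>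
      have h1 := key k; have h2 := key (k + 1)
      unfold supp at h1 h2; omega
    | H l =>
      have h1 := key k; have h2 := key (k + 1)
      unfold supp at h1 h2; congr 1; omega

lemma pval_inj (h : PD x d m tl hd) (a b : V) (ha : DV d m a) (hb : DV d m b)
    (hab : pval x tl hd a = pval x tl hd b) : a = b :=
  supp_eq h ha hb (fun M => by rw [hab])

lemma pval_sq (h : PD x d m tl hd) {a : V} (ha : DV d m a) :
    pval x tl hd a * pval x tl hd a ≠ 1 := by
  cases a with
  | X i => exact h.sq i ha
  | H k => exact h.hsq k ha.1 ha.2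

lemma pset_inv (h : PD x d m tl hd) : ∀ s ∈ pset x d m tl hd, s⁻¹ ∉ pset x d m tl hd := by
  rintro _ ⟨a, ha, rfl⟩ ⟨b, hb, hab⟩
  have : a = b := supp_eq h ha hb (fun M => by rw [hab, inv_mem_iff])
  subst this
  exact pval_sq h ha (by rw [mul_eq_one_iff_eq_inv, ← hab])

lemma rel_supp (h : PD x d m tl hd) {s u w : V} (hs : DV d m s) (hu : DV d m u) (hw : DV d m w)
    (e : pval x tl hd s * pval x tl hd u = pval x tl hd w) :
    ∀ j, (supp s j → supp u j ∨ supp w j) ∧ (supp u j → supp s j ∨ supp w j) ∧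
      (supp w j → supp s j ∨ supp u j) := by
  intro j
  refine ⟨fun hj => ?_, fun hj => ?_, fun hj => ?_⟩
  · by_contra hc
    rw [not_or] at hc
    have hjd := supp_lt hs hj
    have h1 := (mem_M h hu hjd).2 hc.1
    have h2 := (mem_M h hw hjd).2 hc.2
    rw [← e, Subgroup.mul_mem_cancel_right _ h1] at h2
    exact (mem_M h hs hjd).1 h2 hj
  · by_contra hc
    rw [not_or] at hc
    have hjd := supp_lt hu hj
    have h1 := (mem_M h hs hjd).2 hc.1
    have h2 := (mem_M h hw hjd).2 hc.2
    rw [← e, Subgroup.mul_mem_cancel_left _ h1] at h2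
    exact (mem_M h hu hjd).1 h2 hj
  · by_contra hc
    rw [not_or] at hc
    have hjd := supp_lt hw hj
    have h1 := (mem_M h hs hjd).2 hc.1
    have h2 := (mem_M h hu hjd).2 hc.2
    have h3 := Subgroup.mul_mem _ h1 h2
    rw [e] at h3
    exact (mem_M h hw hjd).1 h3 hj

lemma pval_ne_one (h : PD x d m tl hd) {a : V} (ha : DV d m a) : pval x tl hd a ≠ 1 := by
  intro h1
  apply pval_sq h ha
  rw [h1, one_mul]

/-- A pair of distinct indices of an edge is (tail, head) or (head, tail). -/
lemma edge_cases (h : PD x d m tl hd) {i j k : ℕ} (h1 : i = k ∧ j = k + 1 ∨ i = k + 1 ∧ j = k) :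
    (i = tl k ∧ j = hd k) ∨ (i = hd k ∧ j = tl k) := by
  rcases h.ori k with ⟨e1, e2⟩ | ⟨e1, e2⟩ <;> omega

lemma two_edges {k l i : ℕ}
    (h1 : ∀ j, (j = k ∨ j = k + 1) → (j = l ∨ j = l + 1) ∨ j = i)
    (h2 : ∀ j, (j = l ∨ j = l + 1) → (j = k ∨ j = k + 1) ∨ j = i) : k = l := by
  rcases lt_trichotomy k l with h | h | h
  · have a1 := h1 k (Or.inl rfl)
    have a2 := h2 (l + 1) (Or.inr rfl)
    omega
  · exact h
  · have a1 := h1 (k + 1) (Or.inr rfl)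
    have a2 := h2 l (Or.inl rfl)
    omega

lemma three_edges {k l n : ℕ}
    (h1 : ∀ j, (j = k ∨ j = k + 1) → (j = l ∨ j = l + 1) ∨ (j = n ∨ j = n + 1))
    (h2 : ∀ j, (j = l ∨ j = l + 1) → (j = k ∨ j = k + 1) ∨ (j = n ∨ j = n + 1))
    (h3 : ∀ j, (j = n ∨ j = n + 1) → (j = k ∨ j = k + 1) ∨ (j = l ∨ j = l + 1)) :
    k = l := by
  have b1 := h1 k (Or.inl rfl)
  have b2 := h2 l (Or.inl rfl)
  have a1 := h1 (k + 1) (Or.inr rfl)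
  have a2 := h2 (l + 1) (Or.inr rfl)
  have b3 := h3 n (Or.inl rfl)
  have a3 := h3 (n + 1) (Or.inr rfl)
  rcases lt_trichotomy k l with h | h | h
  · have e1 : n = l := by omega
    have e2 : n = k := by omega
    omega
  · exact h
  · have e1 : n = k := by omega
    have e2 : n = l := by omega
    omega

lemma rel_RV (h : PD x d m tl hd) {s u w : V} (hs : DV d m s) (hu : DV d m u) (hw : DV d m w)
    (e : pval x tl hd s * pval x tl hd u = pval x tl hd w) :
    RV d m tl hd (cA x tl hd) (cB x tl hd) (cC x tl hd) u w := by
  have key := rel_supp h hs hu hw e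
  have hs1 := pval_ne_one h hs
  have hu1 := pval_ne_one h hu
  cases s with
  | X i =>
    have ki := key i
    cases u with
    | X j =>
      have kj := key j
      cases w with
      | X l =>
        have kl := key l
        unfold supp at ki kj kl
        have e1 : j = l := by omega
        subst e1
        exact absurd (mul_eq_right.1 e) hs1
      | H k =>
        have kk := key k
        have kk' := key (k + 1)
        unfold supp at ki kj kk kk'
        rcases edge_cases h (i := i) (j := j) (k := k) (by omega) with ⟨rfl, rfl⟩ | ⟨rfl, rfl⟩
        · exact ⟨hw.1, hw.2, e, rfl⟩
        · exfalso
          have e' := mul_left_cancel e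
          simp only [pval] at e'
          exact h.sq _ hu (mul_eq_one_iff_eq_inv.2 e')
    | H k =>
      have kk := key k
      have kk' := key (k + 1)
      cases w with
      | X l =>
        have kl := key l
        unfold supp at ki kl kk kk'
        rcases edge_cases h (i := i) (j := l) (k := k) (by omega) with ⟨rfl, rfl⟩ | ⟨rfl, rfl⟩
        · refine ⟨hu.1, hu.2, Or.inl ⟨?_, rfl⟩⟩
          simp only [pval, ← mul_assoc] at e
          exact mul_inv_eq_iff_eq_mul.1 e
        · refine ⟨hu.1, hu.2, Or.inr ⟨Or.inl ?_, rfl⟩⟩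
          simp only [pval, ← mul_assoc] at e
          exact (mul_inv_eq_iff_eq_mul.1 e).symm
      | H l =>
        exfalso
        have e1 : k = l := two_edges (i := i) (fun j hj => ((key j).2.1 hj).symm)
          (fun j hj => ((key j).2.2 hj).symm)
        subst e1
        exact absurd (mul_eq_right.1 e) hs1
  | H k =>
    have kk := key k
    have kk' := key (k + 1)
    cases u with
    | X j =>
      have kj := key j
      cases w with
      | X l =>
        have kl := key l
        unfold supp at kk kj kl kk'
        rcases edge_cases h (i := j) (j := l) (k := k) (by omega) with ⟨rfl, rfl⟩ | ⟨rfl, rfl⟩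
        · exact ⟨k, hs.1, hs.2, rfl, rfl⟩
        · exfalso
          apply h.hsq k hs.1 hs.2
          simp only [pval] at e
          rw [← mul_assoc, e, mul_inv_cancel]
      | H l =>
        exfalso
        have e1 : k = l := two_edges (i := j) (fun j hj => ((key j).1 hj).symm)
          (fun j hj => (key j).2.2 hj)
        subst e1
        exact absurd (mul_eq_left.1 e) hu1
    | H n =>
      have kn := key n
      have kn' := key (n + 1)
      cases w with
      | X l =>
        have kl := key l
        unfold supp at kk kn kl kk' kn'
        have e1 : n = k := two_edges (i := l) (fun j hj => (key j).2.1 hj)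
          (fun j hj => (key j).1 hj)
        subst e1
        rcases h.ori n with ⟨f1, f2⟩ | ⟨f1, f2⟩
        all_goals
          have hl : l = tl n ∨ l = hd n := by omega
          rcases hl with rfl | rfl
          · exact ⟨hs.1, hs.2, Or.inr ⟨Or.inr e, rfl⟩⟩
          · exfalso
            simp only [pval] at e
            have e2 : x (hd n) = x (tl n) * x (tl n) := by
              have : (x (tl n))⁻¹ * (x (hd n) * (x (tl n))⁻¹) = 1 := by
                rw [mul_assoc] at e
                exact mul_eq_left.1 e
              rw [inv_mul_eq_one] at this
              exact (mul_inv_eq_iff_eq_mul.1 this.symm)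
            refine h.irr (hd n) hw ?_
            rw [e2]
            have ht : x (tl n) ∈ Subgroup.closure {g | ∃ j < d, j ≠ hd n ∧ x j = g} :=
              Subgroup.subset_closure ⟨tl n, by have := hs.2; omega, by omega, rfl⟩
            exact Subgroup.mul_mem _ ht ht
      | H l =>
        exfalso
        have e1 : k = l := three_edges (fun j hj => ((key j).1 hj).symm)
          (fun j hj => (key j).2.2 hj) (fun j hj => (key j).2.1 hj)
        have e2 : n = l := three_edges (fun j hj => ((key j).2.1 hj).symm)
          (fun j hj => ((key j).2.2 hj).symm) (fun j hj => (key j).1 hj)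
        subst e1; subst e2
        exact absurd (mul_eq_left.1 e) hu1

lemma RV_DV (h : PD x d m tl hd) {A B C : ℕ → Prop} {a b : V} (hR : RV d m tl hd A B C a b) :
    DV d m a ∧ DV d m b := by
  cases a with
  | X i =>
    cases b with
    | X j =>
      obtain ⟨k, h1, h2, rfl, rfl⟩ := hR
      simp only [DV]
      rcases h.ori k with ⟨e1, e2⟩ | ⟨e1, e2⟩ <;> omega
    | H k =>
      obtain ⟨h1, h2, h3, rfl⟩ := hR
      simp only [DV]
      rcases h.ori k with ⟨e1, e2⟩ | ⟨e1, e2⟩ <;> omega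
  | H k =>
    cases b with
    | X j =>
      obtain ⟨h1, h2, ⟨h3, rfl⟩ | ⟨h3, rfl⟩⟩ := hR <;>
      simp only [DV] <;>
      rcases h.ori k with ⟨e1, e2⟩ | ⟨e1, e2⟩ <;> omega
    | H k => exact hR.elim

lemma RV_iff (h : PD x d m tl hd) (a b : V) :
    RV d m tl hd (cA x tl hd) (cB x tl hd) (cC x tl hd) a b ↔ DV d m a ∧ DV d m b ∧
      pval x tl hd b * (pval x tl hd a)⁻¹ ∈ pset x d m tl hd := by
  constructor
  · intro hR
    obtain ⟨ha, hb⟩ := RV_DV h hR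
    refine ⟨ha, hb, ?_⟩
    have ht : ∀ k, k + 1 < d → DV d m (X (tl k)) ∧ DV d m (X (hd k)) := by
      intro k hk
      simp only [DV]
      rcases h.ori k with ⟨e1, e2⟩ | ⟨e1, e2⟩ <;> omega
    cases a with
    | X i =>
      cases b with
      | X j =>
        obtain ⟨k, h1, h2, rfl, rfl⟩ := hR
        exact ⟨H k, ⟨h1, h2⟩, rfl⟩
      | H k =>
        obtain ⟨h1, h2, h3, rfl⟩ := hR
        refine ⟨X (tl k), (ht k h2).1, ?_⟩
        simp only [pval]
        exact eq_mul_inv_of_mul_eq h3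
    | H k =>
      cases b with
      | X j =>
        obtain ⟨h1, h2, ⟨h3, rfl⟩ | ⟨h3 | h3, rfl⟩⟩ := hR
        · refine ⟨X (tl k), (ht k h2).1, ?_⟩
          simp only [pval]
          rw [eq_mul_inv_iff_mul_eq, ← mul_assoc, mul_inv_eq_iff_eq_mul]
          exact h3
        · refine ⟨X (hd k), (ht k h2).2, ?_⟩
          simp only [pval]
          rw [eq_mul_inv_iff_mul_eq, ← mul_assoc, mul_inv_eq_iff_eq_mul]
          exact h3.symm
        · refine ⟨H k, ⟨h1, h2⟩, ?_⟩
          simp only [pval]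
          rw [eq_mul_inv_iff_mul_eq]
          exact h3
      | H k => exact hR.elim
  · rintro ⟨ha, hb, s, hs, e⟩
    exact rel_RV h hs ha hb (by rw [e]; group)

lemma path_uclosed (h : PD x d m tl hd) :
    UClosed (RV d m tl hd (cA x tl hd) (cB x tl hd) (cC x tl hd)) (DV d m)
      (fun a => DV d m a → pval x tl hd a ∈ FixSub (pset x d m tl hd)) :=
  uclosed_fix _ (pval_inj h) (fun _ => Iff.rfl) (RV_iff h)

lemma path_H (h : PD x d m tl hd) (k : ℕ) (hk : k + 1 < d)
    (h1 : DV d m (X k) → pval x tl hd (X k) ∈ FixSub (pset x d m tl hd))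
    (h2 : DV d m (X (k + 1)) → pval x tl hd (X (k + 1)) ∈ FixSub (pset x d m tl hd)) :
    DV d m (H k) → pval x tl hd (H k) ∈ FixSub (pset x d m tl hd) := by
  intro _
  simp only [pval, DV] at *
  have h1' := h1 (by omega)
  have h2' := h2 hk
  apply Subgroup.mul_mem _ _ (Subgroup.inv_mem _ _)
  · rcases h.ori k with ⟨e1, e2⟩ | ⟨e1, e2⟩ <;> rw [e2] <;> assumption
  · rcases h.ori k with ⟨e1, e2⟩ | ⟨e1, e2⟩ <;> rw [e1] <;> assumption

lemma orr_of_path (h : PD x d m tl hd)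
    (hgen : Subgroup.closure {g | ∃ j < d, x j = g} = ⊤)
    (hfix : ∀ i, i < d → DV d m (X i) → pval x tl hd (X i) ∈ FixSub (pset x d m tl hd)) :
    HasORR G := by
  apply orr_of_closure (pset_inv h) hgen
  rintro _ ⟨j, hj, rfl⟩
  exact hfix j hj hj

end

end ORR


namespace ORR

variable {G : Type*} [Group G]

open V

/-- Standard path hypotheses. -/
abbrev PD0 (x : ℕ → G) (d m : ℕ) : Prop := PD x d m (fun k => k) (fun k => k + 1)

lemma PD0.mono {x : ℕ → G} {d m m' : ℕ} (h : PD0 x d m) (hm : m ≤ m') : PD0 x d m' :=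
  ⟨h.ori, h.irr, h.sq, fun k h1 h2 => h.hsq k (hm.trans h1) h2⟩

/-- Pair conditions. -/
def pA (p q : G) : Prop := p * q = q * p⁻¹
/-- Pair condition C. -/
def pC (p q : G) : Prop := p * p = q * q ∨ (q * p⁻¹) * (q * p⁻¹) = p

lemma comm_of_D {p q : G} (h : (q * p⁻¹) * (q * p⁻¹) = p) : p * q = q * p := by
  have h1 : Commute (q * p⁻¹) p := by
    have : Commute (q * p⁻¹) ((q * p⁻¹) * (q * p⁻¹)) :=
      Commute.mul_right (Commute.refl _) (Commute.refl _)
    rwa [h] at this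
  have h2 : Commute (q * p⁻¹ * p) p := h1.mul_left (Commute.refl _)
  rw [inv_mul_cancel_right] at h2
  exact h2.eq.symm

lemma not_comm_of_A {p q : G} (hp : p * p ≠ 1) (h : pA p q) : p * q ≠ q * p := by
  intro h1
  apply hp
  rw [pA, h1] at h
  exact mul_eq_one_iff_eq_inv.2 (mul_left_cancel h)

section
variable {x : ℕ → G} {d m : ℕ}

lemma good_finish (h : PD0 x d m) (hm : m ≤ 1) (hd : m + 1 < d)
    (hgen : Subgroup.closure {g | ∃ j < d, x j = g} = ⊤)
    (hfix : ∀ i, m ≤ i → i < d → DV d m (X i) →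
      pval x (fun k => k) (fun k => k + 1) (X i) ∈
        FixSub (pset x d m (fun k => k) (fun k => k + 1))) :
    HasORR G := by
  apply orr_of_path h hgen
  intro i hi
  rcases Nat.lt_or_ge i m with h1 | h1
  · have : i = 0 := by omega
    subst this
    apply pin_last (path_uclosed h)
    · exact hi
    · rintro (j | k) hD
      · rcases Nat.eq_zero_or_pos j with rfl | h2
        · left; rfl
        · right; exact hfix j (by omega) hD
      · right
        exact path_H h k hD.2 (hfix k hD.1 (by have := hD.2; omega))
          (hfix (k + 1) (by have := hD.1; omega) hD.2)
  · exact hfix i h1 hi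

lemma good_CnA (h : PD0 x d m) (hm : m ≤ 1) (hd : m + 1 < d)
    (hgen : Subgroup.closure {g | ∃ j < d, x j = g} = ⊤)
    (hC : pC (x m) (x (m + 1))) (hA : ¬ pA (x m) (x (m + 1))) : HasORR G := by
  apply good_finish h hm hd hgen
  have hF := path_uclosed h
  rw [RV_eq_RP] at hF
  exact chainP hF (fun k _ hk => path_H h k hk) m le_rfl (Or.inl rfl) (pr2P hF hd hA hC)

lemma good_gen (h : PD0 x d m) (hm : m ≤ 1) (hd : m + 1 < d)
    (hgen : Subgroup.closure {g | ∃ j < d, x j = g} = ⊤)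
    (hB : x m * x (m + 1) ≠ x (m + 1) * x m)
    (hAC : ¬ (pA (x m) (x (m + 1)) ∧ x m * x m = x (m + 1) * x (m + 1)))
    (hside : m + 2 < d → pA (x m) (x (m + 1)) → pC (x (m + 1)) (x (m + 2)) →
      pA (x (m + 1)) (x (m + 2))) : HasORR G := by
  apply good_finish h hm hd hgen
  have hF := path_uclosed h
  rw [RV_eq_RP] at hF
  apply goodP hF (fun k _ hk => path_H h k hk) hd hB _ hside
  rintro ⟨h1, h2 | h2⟩
  · exact hAC ⟨h1, h2⟩
  · exact hB (comm_of_D h2)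

lemma good0 (h : PD0 x d 0) (hd : 1 < d)
    (hgen : Subgroup.closure {g | ∃ j < d, x j = g} = ⊤)
    (hB : x 0 * x 1 ≠ x 1 * x 0)
    (hAC : ¬ (pA (x 0) (x 1) ∧ x 0 * x 0 = x 1 * x 1)) : HasORR G := by
  by_cases hs : 2 < d ∧ pC (x 1) (x 2) ∧ ¬ pA (x 1) (x 2)
  · exact good_CnA (h.mono (Nat.zero_le 1)) le_rfl hs.1 hgen hs.2.1 hs.2.2
  · apply good_gen h (by omega) hd hgen hB hAC
    intro h1 _ h2
    by_contra h3
    exact hs ⟨h1, h2, h3⟩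

lemma good1 (h : PD0 x 3 1)
    (hgen : Subgroup.closure {g | ∃ j < 3, x j = g} = ⊤)
    (hB : x 1 * x 2 ≠ x 2 * x 1)
    (hAC : ¬ (pA (x 1) (x 2) ∧ x 1 * x 1 = x 2 * x 2)) : HasORR G := by
  apply good_gen h (by omega) (by omega) hgen hB hAC
  intro h1; omega

lemma orr_ge4 (h : PD0 x d 0) (hd : 4 ≤ d)
    (hgen : Subgroup.closure {g | ∃ j < d, x j = g} = ⊤) : HasORR G := by
  by_cases hB : x 0 * x 1 = x 1 * x 0
  · have h' : PD x d 0 (fun k => if k = 0 then 1 else k) (fun k => if k = 0 then 0 else k + 1) := by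
      refine ⟨?_, h.irr, h.sq, ?_⟩
      · intro k
        rcases Nat.eq_zero_or_pos k with rfl | hk
        · simp
        · left; simp [hk.ne']
      · intro k hk hkd
        rcases Nat.eq_zero_or_pos k with rfl | hk
        · intro h1
          apply h.hsq 0 hk hkd
          simp only [if_true] at h1
          have := congrArg (·⁻¹) h1
          simpa [mul_assoc] using this
        · simp only [hk.ne', if_false]
          exact h.hsq k hk.le hkd
    apply orr_of_path h' hgen
    have hF := path_uclosed h'
    rw [RV_eq_RM _ (by omega)] at hF
    apply commM hF (fun k _ hk => path_H h' k hk) hd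
    intro hA
    simp only [cA, if_true] at hA
    exact not_comm_of_A (h.sq 1 (by omega)) hA hB.symm
  · by_cases hQ : pA (x 0) (x 1) ∧ x 0 * x 0 = x 1 * x 1
    · apply orr_of_path h hgen
      have hF := path_uclosed h
      rw [RV_eq_RP] at hF
      exact quatP hF (fun k _ hk => path_H h k hk) hd hB hQ.1 (Or.inl hQ.2)
    · exact good0 h (by omega) hgen hB hQ

end

end ORR


namespace ORR

variable {G : Type*} [Group G]

/-- Abstract arcs of a gadget given by a set of integer vectors. -/
def RO (T : Finset (ℤ × ℤ)) : Option (ℤ × ℤ) → Option (ℤ × ℤ) → Prop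
  | some u, some v => u ∈ T ∧ v ∈ T ∧ v - u ∈ T
  | _, _ => False

/-- Validity of gadget names. -/
def DO (T : Finset (ℤ × ℤ)) (N : Prop) : Option (ℤ × ℤ) → Prop
  | some u => u ∈ T
  | none => N

/-- Values of gadget names. -/
def gval (f : ℤ × ℤ → G) (a : G) : Option (ℤ × ℤ) → G
  | some u => f u
  | none => a

/-- Rigidity of a gadget. -/
def Rigid (T : Finset (ℤ × ℤ)) (N : Prop) : Prop :=
  ∀ F : Option (ℤ × ℤ) → Prop, UClosed (RO T) (DO T N) F → ∀ t ∈ T, F (some t)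

lemma gadget (f : ℤ × ℤ → G) (hf : ∀ u v, f (u + v) = f u * f v) (T : Finset (ℤ × ℤ)) (N : Prop)
    (a : G) (K : Subgroup G) (hK : ∀ u, f u ∈ K) (ha : N → a ∉ K) (ha2 : a * a ≠ 1)
    (haT : N → ∀ t ∈ T, f t ≠ a * a)
    (hne : ∀ u ∈ T, ∀ v ∈ T, ∀ s ∈ T, f (v - u - s) = 1 → v = u + s)
    (hinj : ∀ u ∈ T, ∀ v ∈ T, f (v - u) = 1 → v = u)
    (hinv : ∀ u ∈ T, ∀ v ∈ T, f (u + v) ≠ 1)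
    (hrig : Rigid T N)
    (hgen : Subgroup.closure {g | ∃ o, DO T N o ∧ gval f a o = g} = ⊤) : HasORR G := by
  have f0 : f 0 = 1 := by
    have := hf 0 0
    rw [add_zero] at this
    exact (mul_eq_left.1 this.symm)
  have fneg : ∀ u, f (-u) = (f u)⁻¹ := by
    intro u
    rw [eq_inv_iff_mul_eq_one, ← hf, neg_add_cancel, f0]
  have fsub : ∀ u v, f (v - u) = f v * (f u)⁻¹ := by
    intro u v
    rw [sub_eq_add_neg, hf, fneg]
  set S : Set G := {g | ∃ o, DO T N o ∧ gval f a o = g} with hS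
  have ft : ∀ t ∈ T, f t ≠ 1 := by
    intro t ht h1
    apply hinv t ht t ht
    rw [hf, h1, one_mul]
  have hF := uclosed_fix (S := S) (gval f a) (D := DO T N) (R := RO T) (by
    rintro (_ | u) (_ | v) h1 h2 h
    · rfl
    · simp only [gval] at h
      exact absurd (h ▸ hK v) (ha h1)
    · simp only [gval] at h
      exact absurd (h ▸ hK u) (ha h2)
    · simp only [gval] at h
      congr 1
      apply hinj v h2 u h1
      rw [fsub, h, mul_inv_cancel]) (fun _ => Iff.rfl) (by
    intro o p
    constructor
    · intro h
      rcases o with _ | u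
      · exact h.elim
      rcases p with _ | v
      · exact h.elim
      obtain ⟨h1, h2, h3⟩ := h
      exact ⟨h1, h2, some (v - u), h3, fsub u v⟩
    · rintro ⟨ho, hp, q, hq, e⟩
      rcases o with _ | u <;> rcases p with _ | v <;> rcases q with _ | s <;>
        simp only [gval, RO] at *
      · simp only [mul_inv_cancel] at e
        exact ha ho (e ▸ K.one_mem)
      · simp only [mul_inv_cancel] at e
        exact ft s hq e
      · rw [eq_mul_inv_iff_mul_eq] at e
        exact haT ho v hp e.symm
      · rw [eq_mul_inv_iff_mul_eq] at e
        apply ha ho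
        rw [← Subgroup.mul_mem_cancel_left K (hK s), e]
        exact hK v
      · exact ft u ho (by simpa using e)
      · apply ha hp
        rw [← Subgroup.mul_mem_cancel_right K (K.inv_mem (hK u)), ← e]
        exact hK s
      · exfalso; apply ha hq
        rw [e]
        exact K.mul_mem (hK v) (K.inv_mem (hK u))
      · refine ⟨ho, hp, ?_⟩
        have := hne u ho v hp s hq (by rw [fsub s, fsub, e, mul_inv_cancel])
        rw [this, add_sub_cancel_left]
        exact hq)
  have h1 := hrig _ hF
  apply orr_of_closure (S := S) _ hgen
  · rintro _ ⟨o, ho, rfl⟩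
    rcases o with _ | u
    · apply pin_last hF
      · exact ho
      · rintro (_ | u) hu
        · left; rfl
        · right; exact h1 u hu
      · exact ho
    · exact h1 u ho ho
  · rintro _ ⟨o, ho, rfl⟩ ⟨p, hp, e⟩
    rcases o with _ | u <;> rcases p with _ | v <;> simp only [gval] at e
    · exact ha2 (mul_eq_one_iff_eq_inv.2 e)
    · apply ha ho
      rw [← inv_inv a, ← e]
      exact K.inv_mem (hK v)
    · apply ha hp
      rw [e]
      exact K.inv_mem (hK u)
    · apply hinv v hp u ho
      rw [hf, e, inv_mul_cancel]

/-- Gadget together with one further element outside of the subgroup. -/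
lemma gadgetA (f : ℤ × ℤ → G) (hf : ∀ u v, f (u + v) = f u * f v) (T : Finset (ℤ × ℤ))
    (a : G) (K : Subgroup G) (hK : ∀ u, f u ∈ K) (ha : a ∉ K) (ha2 : a * a ≠ 1)
    (hne : ∀ u ∈ T, ∀ v ∈ T, ∀ s ∈ T, f (v - u - s) = 1 → v = u + s)
    (hinj : ∀ u ∈ T, ∀ v ∈ T, f (v - u) = 1 → v = u)
    (hinv : ∀ u ∈ T, ∀ v ∈ T, f (u + v) ≠ 1)
    (hrig : Rigid T True)
    (hgen : ∀ M : Subgroup G, a ∈ M → (∀ t ∈ T, f t ∈ M) → M = ⊤) : HasORR G := by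
  have hg : ∀ a' : G, a' = a ∨ a' = a⁻¹ →
      Subgroup.closure {g | ∃ o, DO T True o ∧ gval f a' o = g} = ⊤ := by
    intro a' ha'
    apply hgen
    · have h1 : a' ∈ Subgroup.closure {g | ∃ o, DO T True o ∧ gval f a' o = g} :=
        Subgroup.subset_closure ⟨none, trivial, rfl⟩
      rcases ha' with h | h
      · rwa [h] at h1 ⊢
      · rw [h, inv_mem_iff] at h1; rwa [h]
    · intro t ht
      exact Subgroup.subset_closure ⟨some t, ht, rfl⟩
  by_cases h : ∃ t ∈ T, f t = a * a
  · obtain ⟨t, ht, hta⟩ := h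
    refine gadget f hf T True a⁻¹ K hK (fun _ h => ha (inv_mem_iff.1 h)) ?_ ?_ hne hinj hinv hrig
      (hg _ (Or.inr rfl))
    · intro h1
      apply ha2
      have := congrArg (·⁻¹) h1
      simpa using this
    · intro _ s hs h1
      apply hinv s hs t ht
      rw [hf, hta, h1]
      group
  · push Not at h
    exact gadget f hf T True a K hK (fun _ => ha) ha2 (fun _ => h) hne hinj hinv hrig
      (hg _ (Or.inl rfl))

/-- first gadget -/
def T1 : Finset (ℤ × ℤ) := {(1, 0), (2, 0)}
/-- second gadget -/
def T2 : Finset (ℤ × ℤ) := {(1, 0), (2, 0), (0, 1), (1, 1)}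
/-- third gadget -/
def T3 : Finset (ℤ × ℤ) := {(1, 0), (0, 1), (1, 1), (2, 1)}

lemma RO_list {T : Finset (ℤ × ℤ)} {L : List ((ℤ × ℤ) × (ℤ × ℤ))}
    (h : ∀ u ∈ T, ∀ v ∈ T, v - u ∈ T → (u, v) ∈ L) {o p : Option (ℤ × ℤ)} (hR : RO T o p) :
    ∃ e ∈ L, o = some e.1 ∧ p = some e.2 := by
  rcases o with _ | u
  · exact hR.elim
  rcases p with _ | v
  · exact hR.elim
  exact ⟨(u, v), h u hR.1 v hR.2.1 hR.2.2, rfl, rfl⟩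

lemma rigid1 (N : Prop) : Rigid T1 N := by
  intro F hF
  have hL : ∀ {o p}, RO T1 o p → o = some (1, 0) ∧ p = some (2, 0) := by
    intro o p h
    have := RO_list (L := [((1, 0), (2, 0))]) (by decide) h
    simpa using this
  have h12 : RO T1 (some (1, 0)) (some (2, 0)) := by
    refine ⟨by decide, by decide, by decide⟩
  have h1 : F (some (1, 0)) := by
    refine pin_of_rel hF (fun R w => ∃ v, R w v) ?_ ⟨_, h12⟩ ?_
    · rintro ψ R w ⟨v, hv⟩; exact ⟨_, hv⟩
    · rintro w ⟨v, hv⟩; exact Or.inl (hL hv).1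
  have h2 : F (some (2, 0)) := pin_out hF h1 h12 (fun w hw => Or.inl (hL hw).2)
  intro t ht
  simp only [T1, Finset.mem_insert, Finset.mem_singleton] at ht
  rcases ht with rfl | rfl <;> assumption

lemma rigid2 (N : Prop) : Rigid T2 N := by
  intro F hF
  have hL : ∀ {o p}, RO T2 o p → (o = some (1, 0) ∧ p = some (2, 0)) ∨
      (o = some (1, 0) ∧ p = some (1, 1)) ∨ (o = some (0, 1) ∧ p = some (1, 1)) := by
    intro o p h
    have := RO_list (L := [((1, 0), (2, 0)), ((1, 0), (1, 1)), ((0, 1), (1, 1))]) (by decide) h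
    simpa using this
  have e1 : RO T2 (some (1, 0)) (some (2, 0)) := ⟨by decide, by decide, by decide⟩
  have e2 : RO T2 (some (1, 0)) (some (1, 1)) := ⟨by decide, by decide, by decide⟩
  have e3 : RO T2 (some (0, 1)) (some (1, 1)) := ⟨by decide, by decide, by decide⟩
  have h1 : F (some (1, 0)) := by
    refine pin_of_rel hF (fun R w => ∃ v, R w v ∧ ∀ u, R u v → u = w) ?_ ⟨some (2, 0), e1, ?_⟩ ?_
    · rintro ψ R w ⟨v, hv, h⟩
      refine ⟨_, hv, fun u hu => ?_⟩
      rw [← h (ψ.symm u) (by simpa using hu)]; simp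
    · intro u hu
      rcases hL hu with h | h | h
      · exact h.1
      · exact h.1
      · simp at h
    · rintro w ⟨v, hv, h⟩
      rcases hL hv with h' | h' | h'
      · exact Or.inl h'.1
      · exact Or.inl h'.1
      · rw [h'.2] at h
        exact Or.inl (h _ e2).symm
  have h2 : F (some (2, 0)) := by
    refine hF (fun w => RO T2 (some (1, 0)) w ∧ ∀ u, RO T2 u w → u = some (1, 0)) ?_ _ ⟨e1, ?_⟩ ?_
    · rintro ψ h1' h2' h3 w ⟨hw, h⟩
      have h4 := h3 _ h1
      refine ⟨?_, fun u hu => ?_⟩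
      · rw [← h4, h1']; exact hw
      · have := h (ψ.symm u) (by rw [← h1']; simpa using hu)
        rw [Equiv.symm_apply_eq] at this
        rw [this, h4]
    · intro u hu
      rcases hL hu with h | h | h
      · exact h.1
      · exact h.1
      · simp at h
    · rintro w ⟨hw, h⟩
      rcases hL hw with h' | h' | h'
      · exact Or.inl h'.2
      · rw [h'.2] at h
        exact absurd (h _ e3) (by simp)
      · simp at h'
  have h3 : F (some (1, 1)) := pin_out hF h1 e2 (fun w hw => by
    rcases hL hw with h | h | h
    · right; rw [h.2]; exact h2
    · exact Or.inl h.2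
    · exact Or.inl h.2)
  have h4 : F (some (0, 1)) := pin_in hF h3 e3 (fun w hw => by
    rcases hL hw with h | h | h
    · simp at h
    · right; rw [h.1]; exact h1
    · exact Or.inl h.1)
  intro t ht
  simp only [T2, Finset.mem_insert, Finset.mem_singleton] at ht
  rcases ht with rfl | rfl | rfl | rfl <;> assumption

lemma rigid3 (N : Prop) : Rigid T3 N := by
  intro F hF
  have hL : ∀ {o p}, RO T3 o p → (o = some (0, 1) ∧ p = some (1, 1)) ∨
      (o = some (1, 0) ∧ p = some (1, 1)) ∨ (o = some (1, 0) ∧ p = some (2, 1)) ∨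
      (o = some (1, 1) ∧ p = some (2, 1)) := by
    intro o p h
    have := RO_list (L := [((0, 1), (1, 1)), ((1, 0), (1, 1)), ((1, 0), (2, 1)),
      ((1, 1), (2, 1))]) (by decide) h
    simpa using this
  have e1 : RO T3 (some (0, 1)) (some (1, 1)) := ⟨by decide, by decide, by decide⟩
  have e2 : RO T3 (some (1, 0)) (some (1, 1)) := ⟨by decide, by decide, by decide⟩
  have e3 : RO T3 (some (1, 0)) (some (2, 1)) := ⟨by decide, by decide, by decide⟩
  have e4 : RO T3 (some (1, 1)) (some (2, 1)) := ⟨by decide, by decide, by decide⟩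
  have h1 : F (some (1, 1)) := by
    refine pin_of_rel hF (fun R w => (∃ v, R w v) ∧ ∃ v, R v w) ?_ ⟨⟨_, e4⟩, ⟨_, e1⟩⟩ ?_
    · rintro ψ R w ⟨⟨v, hv⟩, ⟨u, hu⟩⟩
      exact ⟨⟨_, hv⟩, ⟨_, hu⟩⟩
    · rintro w ⟨⟨v, hv⟩, ⟨u, hu⟩⟩
      left
      rcases hL hv with h | h | h | h <;> rcases hL hu with h' | h' | h' | h' <;>
        first
        | exact h.1
        | exact h'.2
        | (rw [h.1] at h'; simp at h')
  have h2 : F (some (2, 1)) := pin_out hF h1 e4 (fun w hw => by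
    rcases hL hw with h | h | h | h
    · simp at h
    · simp at h
    · simp at h
    · exact Or.inl h.2)
  have h3 : F (some (1, 0)) := pin_in hF h2 e3 (fun w hw => by
    rcases hL hw with h | h | h | h
    · simp at h
    · simp at h
    · exact Or.inl h.1
    · right; rw [h.1]; exact h1)
  have h4 : F (some (0, 1)) := pin_in hF h1 e1 (fun w hw => by
    rcases hL hw with h | h | h | h
    · exact Or.inl h.1
    · right; rw [h.1]; exact h3
    · simp at h
    · simp at h)
  intro t ht
  simp only [T3, Finset.mem_insert, Finset.mem_singleton] at ht
  rcases ht with rfl | rfl | rfl | rfl <;> assumption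

end ORR


namespace ORR

variable {G : Type*} [Group G]

/-- Exponent vectors that are detected as nontrivial. -/
def GoodW (n m : ℤ) (w : ℤ × ℤ) : Prop :=
  w.2 = 1 ∨ w.2 = -1 ∨ (w.2 = 0 ∧ 1 ≤ w.1 ∧ w.1 ≤ n) ∨ (w.2 = 0 ∧ -n ≤ w.1 ∧ w.1 ≤ -1) ∨
    (w.2 = 2 ∧ -m ≤ w.1 ∧ w.1 ≤ m) ∨ (w.2 = -2 ∧ -m ≤ w.1 ∧ w.1 ≤ m)

instance (n m : ℤ) (w : ℤ × ℤ) : Decidable (GoodW n m w) := by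
  unfold GoodW; infer_instance

lemma goodW_ne {b c : G} {n m : ℤ} (h1 : b ∉ Subgroup.zpowers c)
    (hc : ∀ k : ℤ, 1 ≤ k → k ≤ n → c ^ k ≠ 1)
    (hb : ∀ k : ℤ, -m ≤ k → k ≤ m → b * b ≠ c ^ k) (w : ℤ × ℤ) (hw : GoodW n m w) :
    c ^ w.1 * b ^ w.2 ≠ 1 := by
  obtain ⟨i, j⟩ := w
  unfold GoodW at hw
  simp only at hw ⊢
  intro h
  rcases hw with h2 | h2 | h2 | h2 | h2 | h2
  · subst h2
    rw [zpow_one, mul_eq_one_iff_eq_inv'] at h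
    exact h1 (h ▸ inv_mem ⟨i, rfl⟩)
  · subst h2
    rw [zpow_neg_one, mul_eq_one_iff_eq_inv', inv_inj] at h
    exact h1 (h ▸ ⟨i, rfl⟩)
  · rw [h2.1, zpow_zero, mul_one] at h
    exact hc i h2.2.1 h2.2.2 h
  · rw [h2.1, zpow_zero, mul_one] at h
    exact hc (-i) (by omega) (by omega) (by rw [zpow_neg, h, inv_one])
  · rw [h2.1, mul_eq_one_iff_eq_inv', ← zpow_neg] at h
    exact hb (-i) (by omega) (by omega) (by rw [← h, zpow_ofNat, pow_two])
  · rw [h2.1, zpow_neg, mul_eq_one_iff_eq_inv', inv_inj] at h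
    exact hb i h2.2.1 h2.2.2 (by rw [← h, zpow_ofNat, pow_two])

/-- The lattice map. -/
def fmap (b c : G) (w : ℤ × ℤ) : G := c ^ w.1 * b ^ w.2

lemma fmap_add {b c : G} (h : b * c = c * b) (u v : ℤ × ℤ) :
    fmap b c (u + v) = fmap b c u * fmap b c v := by
  have h1 : Commute (b ^ u.2) (c ^ v.1) := (show Commute b c from h).zpow_zpow _ _
  unfold fmap
  rw [Prod.fst_add, Prod.snd_add, zpow_add, zpow_add, mul_assoc, mul_assoc]
  congr 1
  rw [← mul_assoc, ← mul_assoc, h1.eq]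

lemma L2 {a b c : G} (hcm : b * c = c * b) (hc : ∀ k : ℤ, 1 ≤ k → k ≤ 4 → c ^ k ≠ 1)
    (h1 : b ∉ Subgroup.zpowers c)
    (hb : ∀ k : ℤ, -2 ≤ k → k ≤ 2 → b * b ≠ c ^ k)
    (ha : a ∉ Subgroup.closure {b, c}) (ha2 : a * a ≠ 1)
    (hgen : ∀ M : Subgroup G, a ∈ M → b ∈ M → c ∈ M → M = ⊤) : HasORR G := by
  have hg := goodW_ne h1 hc hb
  apply gadgetA (fmap b c) (fmap_add hcm) T2 a (Subgroup.closure {b, c}) _ ha ha2 _ _ _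
    (rigid2 True)
  · intro M h2 h3
    apply hgen M h2
    · simpa [fmap] using h3 (0, 1) (by decide)
    · simpa [fmap] using h3 (1, 0) (by decide)
  · intro u
    exact mul_mem (zpow_mem (Subgroup.subset_closure (by simp)) _)
      (zpow_mem (Subgroup.subset_closure (by simp)) _)
  · intro u hu v hv s hs h
    by_contra h2
    have : ∀ u ∈ T2, ∀ v ∈ T2, ∀ s ∈ T2, v ≠ u + s → GoodW 4 2 (v - u - s) := by decide
    exact hg _ (this u hu v hv s hs h2) h
  · intro u hu v hv h
    by_contra h2
    have : ∀ u ∈ T2, ∀ v ∈ T2, v ≠ u → GoodW 4 2 (v - u) := by decide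
    exact hg _ (this u hu v hv h2) h
  · intro u hu v hv h
    have : ∀ u ∈ T2, ∀ v ∈ T2, GoodW 4 2 (u + v) := by decide
    exact hg _ (this u hu v hv) h

lemma L1 {a c : G} (hc : ∀ k : ℤ, 1 ≤ k → k ≤ 4 → c ^ k ≠ 1)
    (ha : a ∉ Subgroup.zpowers c) (ha2 : a * a ≠ 1)
    (hgen : ∀ M : Subgroup G, a ∈ M → c ∈ M → M = ⊤) : HasORR G := by
  have hg : ∀ w : ℤ × ℤ, ((1 ≤ w.1 ∧ w.1 ≤ 4) ∨ (-4 ≤ w.1 ∧ w.1 ≤ -1)) → c ^ w.1 ≠ 1 := by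
    rintro ⟨i, j⟩ (h | h)
    · exact hc i h.1 h.2
    · have := hc (-i) (by simp only at h; omega) (by simp only at h; omega)
      simpa using this
  apply gadgetA (fun w => c ^ w.1) (fun u v => by rw [Prod.fst_add, zpow_add]) T1 a
    (Subgroup.zpowers c) _ ha ha2 _ _ _ (rigid1 True)
  · intro M h2 h3
    apply hgen M h2
    simpa using h3 (1, 0) (by decide)
  · intro u
    exact ⟨_, rfl⟩
  · intro u hu v hv s hs h
    by_contra h2
    have : ∀ u ∈ T1, ∀ v ∈ T1, ∀ s ∈ T1, v ≠ u + s →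
      ((1 ≤ (v - u - s).1 ∧ (v - u - s).1 ≤ 4) ∨ (-4 ≤ (v - u - s).1 ∧ (v - u - s).1 ≤ -1)) := by
      decide
    exact hg _ (this u hu v hv s hs h2) h
  · intro u hu v hv h
    by_contra h2
    have : ∀ u ∈ T1, ∀ v ∈ T1, v ≠ u →
      ((1 ≤ (v - u).1 ∧ (v - u).1 ≤ 4) ∨ (-4 ≤ (v - u).1 ∧ (v - u).1 ≤ -1)) := by decide
    exact hg _ (this u hu v hv h2) h
  · intro u hu v hv h
    have : ∀ u ∈ T1, ∀ v ∈ T1,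
      ((1 ≤ (u + v).1 ∧ (u + v).1 ≤ 4) ∨ (-4 ≤ (u + v).1 ∧ (u + v).1 ≤ -1)) := by decide
    exact hg _ (this u hu v hv) h

/-- Facts for the third gadget. -/
lemma L3_aux {b c : G} (hc : ∀ k : ℤ, 1 ≤ k → k ≤ 3 → c ^ k ≠ 1)
    (h1 : b ∉ Subgroup.zpowers c) (hb : ∀ k : ℤ, -6 ≤ k → k ≤ 6 → b * b ≠ c ^ k) :
    (∀ u ∈ T3, ∀ v ∈ T3, ∀ s ∈ T3, fmap b c (v - u - s) = 1 → v = u + s) ∧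
    (∀ u ∈ T3, ∀ v ∈ T3, fmap b c (v - u) = 1 → v = u) ∧
    (∀ u ∈ T3, ∀ v ∈ T3, fmap b c (u + v) ≠ 1) := by
  have hg := goodW_ne h1 hc hb
  refine ⟨?_, ?_, ?_⟩
  · intro u hu v hv s hs h
    by_contra h2
    have : ∀ u ∈ T3, ∀ v ∈ T3, ∀ s ∈ T3, v ≠ u + s → GoodW 3 6 (v - u - s) := by decide
    exact hg _ (this u hu v hv s hs h2) h
  · intro u hu v hv h
    by_contra h2
    have : ∀ u ∈ T3, ∀ v ∈ T3, v ≠ u → GoodW 3 6 (v - u) := by decide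
    exact hg _ (this u hu v hv h2) h
  · intro u hu v hv h
    have : ∀ u ∈ T3, ∀ v ∈ T3, GoodW 3 6 (u + v) := by decide
    exact hg _ (this u hu v hv) h

lemma L3 {a b c : G} (hcm : b * c = c * b) (hc : ∀ k : ℤ, 1 ≤ k → k ≤ 3 → c ^ k ≠ 1)
    (h1 : b ∉ Subgroup.zpowers c)
    (hb : ∀ k : ℤ, -6 ≤ k → k ≤ 6 → b * b ≠ c ^ k)
    (ha : a ∉ Subgroup.closure {b, c}) (ha2 : a * a ≠ 1)
    (hgen : ∀ M : Subgroup G, a ∈ M → b ∈ M → c ∈ M → M = ⊤) : HasORR G := by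
  obtain ⟨e1, e2, e3⟩ := L3_aux hc h1 hb
  apply gadgetA (fmap b c) (fmap_add hcm) T3 a (Subgroup.closure {b, c}) _ ha ha2 e1 e2 e3
    (rigid3 True)
  · intro M h2 h3
    apply hgen M h2
    · simpa [fmap] using h3 (0, 1) (by decide)
    · simpa [fmap] using h3 (1, 0) (by decide)
  · intro u
    exact mul_mem (zpow_mem (Subgroup.subset_closure (by simp)) _)
      (zpow_mem (Subgroup.subset_closure (by simp)) _)

lemma L3' {b c : G} (hcm : b * c = c * b) (hc : ∀ k : ℤ, 1 ≤ k → k ≤ 3 → c ^ k ≠ 1)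
    (h1 : b ∉ Subgroup.zpowers c)
    (hb : ∀ k : ℤ, -6 ≤ k → k ≤ 6 → b * b ≠ c ^ k)
    (hgen : ∀ M : Subgroup G, b ∈ M → c ∈ M → M = ⊤) : HasORR G := by
  obtain ⟨e1, e2, e3⟩ := L3_aux hc h1 hb
  apply gadget (fmap b c) (fmap_add hcm) T3 False c ⊤ _ (fun h => h.elim) _ (fun h => h.elim)
    e1 e2 e3 (rigid3 False)
  · apply hgen
    · exact Subgroup.subset_closure ⟨some (0, 1), (show _ ∈ T3 by decide), by simp [gval, fmap]⟩
    · exact Subgroup.subset_closure ⟨some (1, 0), (show _ ∈ T3 by decide), by simp [gval, fmap]⟩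
  · intro u; trivial
  · have := hc 2 (by norm_num) (by norm_num)
    rwa [zpow_ofNat, pow_two] at this

end ORR


namespace ORR

variable {G : Type*} [Group G]

lemma cp_big {a b c : G} (hcm : b * c = c * b) (hb : b ∉ Subgroup.zpowers c)
    (hc : c ∉ Subgroup.zpowers b) (ha : a ∉ Subgroup.closure {b, c}) (ha2 : a * a ≠ 1)
    (hb2 : b * b ≠ 1) (hc2 : c * c ≠ 1) (hd : (c * b⁻¹) * (c * b⁻¹) ≠ 1)
    (hgen : ∀ M : Subgroup G, a ∈ M → b ∈ M → c ∈ M → M = ⊤)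
    (h3 : c ^ 3 ≠ 1) (h4 : c ^ 4 ≠ 1) :
    HasORR G ∨ (b ^ 6 = 1 ∧ c ^ 6 = 1 ∧ (b * c) ^ 2 = 1) := by
  have hC : Commute b c := hcm
  have c1 : c ≠ 1 := fun h => hc2 (by rw [h, one_mul])
  have hck : ∀ k : ℤ, 1 ≤ k → k ≤ 4 → c ^ k ≠ 1 := by
    intro k h1 h2
    interval_cases k
    · simpa using c1
    · rwa [zpow_ofNat, pow_two]
    · rwa [zpow_ofNat]
    · rwa [zpow_ofNat]
  by_cases hx : b * b * (c * c) = 1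
  · have hbb : b ^ 2 = (c ^ 2)⁻¹ := by
      rw [pow_two, pow_two]; exact mul_eq_one_iff_eq_inv.1 hx
    by_cases h6 : c ^ 6 = 1
    · right
      refine ⟨?_, h6, ?_⟩
      · rw [show 6 = 2 * 3 from rfl, pow_mul, hbb, inv_pow, ← pow_mul, h6, inv_one]
      · rw [hC.mul_pow, hbb, inv_mul_cancel]
    · left
      have h5 : c ^ 5 ≠ 1 := by
        intro h5
        apply hc
        have h7 : c = ((b ^ 2)⁻¹) ^ 3 := by
          rw [hbb, inv_inv, ← pow_mul, show 2 * 3 = 5 + 1 from rfl, pow_add, h5, pow_one, one_mul]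
        rw [h7]
        exact pow_mem (inv_mem (pow_mem (Subgroup.mem_zpowers b) 2)) 3
      have hcB : c ∈ Subgroup.closure {b, c} := Subgroup.subset_closure (by simp)
      have hbB : b ∈ Subgroup.closure {b, c} := Subgroup.subset_closure (by simp)
      apply L2 (a := a) (b := c ^ 3 * b) (c := c) _ hck _ _ _ ha2
      · intro M m1 m2 m3
        apply hgen M m1 _ m3
        rwa [Subgroup.mul_mem_cancel_left M (pow_mem m3 3)] at m2
      · rw [mul_assoc, hcm, ← mul_assoc, ← mul_assoc, ← pow_succ, ← pow_succ']
      · rw [Subgroup.mul_mem_cancel_left _ (pow_mem (Subgroup.mem_zpowers c) 3)]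
        exact hb
      · intro k k1 k2 h
        have h8 : c ^ 3 * b * (c ^ 3 * b) = c ^ (4 : ℤ) := by
          rw [← pow_two, (hC.symm.pow_left 3).mul_pow, hbb, ← pow_mul]
          group
        rw [h8, eq_comm, ← mul_inv_eq_one, ← zpow_neg, ← zpow_add] at h
        have h9 : c ^ (4 - k) = 1 := by
          have := congrArg (·⁻¹) h
          simp only [← zpow_neg, inv_one] at this
          rw [← this]; congr 1; ring
        have k3 : 2 ≤ 4 - k := by omega
        have k4 : 4 - k ≤ 6 := by omega
        generalize 4 - k = l at *
        rcases lt_or_ge l 5 with h' | h'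
        · exact hck l (by omega) (by omega) h9
        · have : l = 5 ∨ l = 6 := by omega
          rcases this with rfl | rfl
          · exact h5 (by rwa [zpow_ofNat] at h9)
          · exact h6 (by rwa [zpow_ofNat] at h9)
      · intro h
        apply ha
        refine (Subgroup.closure_le _).2 ?_ h
        rintro x (rfl | rfl)
        · exact mul_mem (pow_mem hcB 3) hbB
        · exact hcB
  · left
    apply L2 hcm hck hb _ ha ha2 hgen
    intro k k1 k2 h
    have hbz : b * b ∈ Subgroup.zpowers b := mul_mem (Subgroup.mem_zpowers b) (Subgroup.mem_zpowers b)
    interval_cases k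
    · apply hx
      rw [h]; group
    · apply hc
      rw [zpow_neg_one] at h
      rw [h] at hbz
      exact inv_mem_iff.1 hbz
    · exact hb2 (by simpa using h)
    · apply hc
      rw [zpow_one] at h
      rwa [h] at hbz
    · apply hd
      rw [← pow_two, hC.symm.inv_right.mul_pow, inv_pow, pow_two b, h, zpow_ofNat, mul_inv_cancel]

lemma cp_34 {a b c : G} (hcm : b * c = c * b) 
    (ha : a ∉ Subgroup.closure {b, c}) (ha2 : a * a ≠ 1)
    (hb2 : b * b ≠ 1) (hc2 : c * c ≠ 1) (hd : (c * b⁻¹) * (c * b⁻¹) ≠ 1)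
    (hgen : ∀ M : Subgroup G, a ∈ M → b ∈ M → c ∈ M → M = ⊤)
    (h3 : b ^ 3 = 1) (h4 : c ^ 4 = 1) : HasORR G := by
  have hC : Commute c b⁻¹ := Commute.inv_right hcm.symm
  have e4 : (c * b⁻¹) ^ 4 = b⁻¹ := by
    rw [hC.mul_pow, h4, one_mul, inv_pow, show 4 = 3 + 1 from rfl, pow_add, h3, one_mul, pow_one]
  have e9 : (c * b⁻¹) ^ 9 = c := by
    rw [hC.mul_pow, inv_pow, show b ^ 9 = (b ^ 3) ^ 3 by rw [← pow_mul], h3,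
      show 9 = 4 * 2 + 1 from rfl, pow_add, pow_mul, h4]
    simp
  have c1 : c ≠ 1 := fun h => hc2 (by rw [h, one_mul])
  have b1 : b ≠ 1 := fun h => hb2 (by rw [h, one_mul])
  have hcB : c ∈ Subgroup.closure {b, c} := Subgroup.subset_closure (by simp)
  have hbB : b ∈ Subgroup.closure {b, c} := Subgroup.subset_closure (by simp)
  apply L1 (a := a) (c := c * b⁻¹) _ _ ha2
  · intro M m1 m2
    apply hgen M m1
    · have := pow_mem m2 4
      rw [e4] at this
      exact inv_mem_iff.1 this
    · have := pow_mem m2 9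
      rwa [e9] at this
  · intro k k1 k2 h
    interval_cases k
    · apply hd
      rw [zpow_one] at h
      rw [h, one_mul]
    · apply hd
      rwa [zpow_ofNat, pow_two] at h
    · rw [zpow_ofNat, hC.mul_pow, inv_pow, h3, inv_one, mul_one] at h
      apply c1
      rw [← h4, pow_succ, h, one_mul]
    · rw [zpow_ofNat, e4, inv_eq_one] at h
      exact b1 h
  · intro h
    apply ha
    refine (Subgroup.zpowers_le.2 ?_) h
    exact mul_mem hcB (inv_mem hbB)

lemma cp_44_aux {b c : G} (hcm : b * c = c * b) 
    (hb2 : b * b ≠ 1) (hc2 : c * c ≠ 1) (hd : (c * b⁻¹) * (c * b⁻¹) ≠ 1)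
    (h3 : b ^ 4 = 1) (h4 : c ^ 4 = 1) : (∀ k : ℤ, 1 ≤ k → k ≤ 3 → c ^ k ≠ 1) ∧
      (∀ k : ℤ, -6 ≤ k → k ≤ 6 → b * b ≠ c ^ k) := by
  have hC : Commute c b⁻¹ := Commute.inv_right hcm.symm
  have c1 : c ≠ 1 := fun h => hc2 (by rw [h, one_mul])
  have hc4 : c ^ (4 : ℤ) = 1 := by rwa [zpow_ofNat]
  have hbc : b * b ≠ c ^ 2 := by
    intro h
    apply hd
    rw [← pow_two, hC.mul_pow, inv_pow, pow_two b, h, mul_inv_cancel]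
  have hbb : (b * b) * (b * b) = 1 := by rw [← h3, ← pow_two, ← pow_two, ← pow_mul]
  constructor
  · intro k k1 k2 h
    interval_cases k
    · exact c1 (by simpa using h)
    · apply hc2
      rwa [zpow_ofNat, pow_two] at h
    · apply c1
      rw [← h4, pow_succ]
      rw [zpow_ofNat] at h
      rw [h, one_mul]
  · intro k _ _ h
    have hk : k = 4 * (k / 4) + k % 4 := by omega
    have h1 : 0 ≤ k % 4 := by omega
    have h2 : k % 4 < 4 := by omega
    rw [hk, zpow_add, zpow_mul, hc4, one_zpow, one_mul] at h
    generalize k % 4 = l at *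
    interval_cases l
    · exact hb2 (by simpa using h)
    · rw [h, zpow_one] at hbb
      exact hc2 hbb
    · apply hbc
      rw [h, zpow_ofNat]
    · apply hc2
      rw [h, ← zpow_add, show (3 : ℤ) + 3 = 4 + 2 from rfl, zpow_add, hc4, one_mul, zpow_ofNat,
        pow_two] at hbb
      exact hbb

lemma CP {a b c : G} (hcm : b * c = c * b) (hb : b ∉ Subgroup.zpowers c)
    (hc : c ∉ Subgroup.zpowers b) (ha : a ∉ Subgroup.closure {b, c}) (ha2 : a * a ≠ 1)
    (hb2 : b * b ≠ 1) (hc2 : c * c ≠ 1) (hd : (c * b⁻¹) * (c * b⁻¹) ≠ 1)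
    (hgen : ∀ M : Subgroup G, a ∈ M → b ∈ M → c ∈ M → M = ⊤) :
    HasORR G ∨ (b ^ 3 = 1 ∧ c ^ 3 = 1) ∨ (b ^ 6 = 1 ∧ c ^ 6 = 1 ∧ (b * c) ^ 2 = 1) := by
  have ha' : a ∉ Subgroup.closure {c, b} := by rwa [Set.pair_comm]
  have hd' : (b * c⁻¹) * (b * c⁻¹) ≠ 1 := by
    intro h
    apply hd
    have := congrArg (·⁻¹) h
    simpa [mul_assoc] using this
  have hgen' : ∀ M : Subgroup G, a ∈ M → c ∈ M → b ∈ M → M = ⊤ := fun M h1 h2 h3 => hgen M h1 h3 h2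
  by_cases h1 : c ^ 3 ≠ 1 ∧ c ^ 4 ≠ 1
  · rcases cp_big hcm hb hc ha ha2 hb2 hc2 hd hgen h1.1 h1.2 with h | h
    · exact Or.inl h
    · exact Or.inr (Or.inr h)
  by_cases h2 : b ^ 3 ≠ 1 ∧ b ^ 4 ≠ 1
  · rcases cp_big hcm.symm hc hb ha' ha2 hc2 hb2 hd' hgen' h2.1 h2.2 with h | h
    · exact Or.inl h
    · exact Or.inr (Or.inr ⟨h.2.1, h.1, by rw [hcm]; exact h.2.2⟩)
  by_cases hc3 : c ^ 3 = 1
  · by_cases hb3 : b ^ 3 = 1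
    · exact Or.inr (Or.inl ⟨hb3, hc3⟩)
    · left
      exact cp_34 hcm.symm ha' ha2 hc2 hb2 hd' hgen' hc3 (by tauto)
  · have hc4 : c ^ 4 = 1 := by tauto
    left
    by_cases hb3 : b ^ 3 = 1
    · exact cp_34 hcm ha ha2 hb2 hc2 hd hgen hb3 hc4
    · have hb4 : b ^ 4 = 1 := by tauto
      obtain ⟨e1, e2⟩ := cp_44_aux hcm hb2 hc2 hd hb4 hc4
      exact L3 hcm e1 hb e2 ha ha2 hgen

end ORR


namespace ORR

variable {G : Type*} [Group G]

section
variable {A : Type*} [AddGroup A]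

/-- Additive-to-multiplicative homomorphisms. -/
def AH (p : A → G) : Prop := ∀ x y, p (x + y) = p x * p y

lemma AH.mul {p q : A → G} (hp : AH p) (hq : AH q) (h : ∀ x y, Commute (p x) (q y)) :
    AH (fun x => p x * q x) := by
  intro x y
  simp only
  rw [hp, hq, mul_assoc, mul_assoc, ← mul_assoc (p y), (h y x).eq, mul_assoc]

lemma AH_pow {n : ℕ} [NeZero n] {g : G} (hg : g ^ n = 1) (π : A → ZMod n)
    (hπ : ∀ x y, π (x + y) = π x + π y) :
    AH (fun x => g ^ (π x).val) := by
  intro x y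
  simp only
  rw [hπ, ZMod.val_add, ← pow_eq_pow_mod _ hg, pow_add]

lemma iso_of_AH {p : A → G} (hp : AH p) (hk : ∀ x, p x = 1 → x = 0)
    (hgen : ∀ M : Subgroup G, (∀ x, p x ∈ M) → M = ⊤) : Nonempty (G ≃* Multiplicative A) := by
  let f : Multiplicative A →* G := MonoidHom.mk' (fun x => p x.toAdd) (fun x y => hp _ _)
  refine ⟨(MulEquiv.ofBijective f ⟨?_, ?_⟩).symm⟩
  · rw [injective_iff_map_eq_one]
    intro x hx
    exact hk _ hx
  · rw [← MonoidHom.range_eq_top]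
    apply hgen
    intro x
    exact ⟨Multiplicative.ofAdd x, rfl⟩
end

lemma v1 : (ZMod.val (1 : ZMod 3)) = 1 := rfl

lemma val3 (i : ZMod 3) (h : i ≠ 0) : i.val = 1 ∨ i.val = 2 := by
  revert i; decide

lemma val2 (i : ZMod 2) (h : i ≠ 0) : i.val = 1 := by
  revert i; decide

lemma mem_of_pow3 {g : G} {M : Subgroup G} (h3 : g ^ 3 = 1) {i : ZMod 3} (hi : i ≠ 0)
    (h : g ^ i.val ∈ M) : g ∈ M := by
  rcases val3 i hi with h1 | h1
  · rwa [h1, pow_one] at h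
  · rw [h1] at h
    have : g = (g ^ 2)⁻¹ := by rw [eq_inv_iff_mul_eq_one, ← pow_succ', h3]
    rw [this]
    exact inv_mem h

lemma iso33 {a b : G} (hcm : a * b = b * a) (ha : a ^ 3 = 1) (hb : b ^ 3 = 1) (hb1 : b ≠ 1)
    (hab : a ∉ Subgroup.zpowers b)
    (hgen : ∀ M : Subgroup G, a ∈ M → b ∈ M → M = ⊤) :
    Nonempty (G ≃* Multiplicative (ZMod 3 × ZMod 3)) := by
  apply iso_of_AH (p := fun x : ZMod 3 × ZMod 3 => a ^ x.1.val * b ^ x.2.val)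
  · exact AH.mul (AH_pow ha (fun x : ZMod 3 × ZMod 3 => x.1) (fun _ _ => rfl)) (AH_pow hb (fun x : ZMod 3 × ZMod 3 => x.2) (fun _ _ => rfl))
      (fun x y => Commute.pow_pow hcm _ _)
  · rintro ⟨i, j⟩ h
    simp only at h
    have hi : i = 0 := by
      by_contra hi
      apply hab
      apply mem_of_pow3 ha hi
      rw [mul_eq_one_iff_eq_inv] at h
      rw [h]
      exact inv_mem (pow_mem (Subgroup.mem_zpowers b) _)
    subst hi
    rw [ZMod.val_zero, pow_zero, one_mul] at h
    have hj : j = 0 := by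
      by_contra hj
      apply hb1
      have := mem_of_pow3 (M := ⊥) hb hj h
      exact this
    subst hj
    rfl
  · intro M hM
    apply hgen
    · simpa [v1] using hM (1, 0)
    · simpa [v1] using hM (0, 1)

lemma iso333 {a b c : G} (hab : a * b = b * a) (hac : a * c = c * a) (hbc : b * c = c * b)
    (ha : a ^ 3 = 1) (hb : b ^ 3 = 1) (hc : c ^ 3 = 1)
    (ia : a ∉ Subgroup.closure {b, c}) (ib : b ∉ Subgroup.zpowers c) (ic : c ≠ 1)
    (hgen : ∀ M : Subgroup G, a ∈ M → b ∈ M → c ∈ M → M = ⊤) :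
    Nonempty (G ≃* Multiplicative (ZMod 3 × ZMod 3 × ZMod 3)) := by
  apply iso_of_AH (p := fun x : ZMod 3 × ZMod 3 × ZMod 3 =>
    a ^ x.1.val * (b ^ x.2.1.val * c ^ x.2.2.val))
  · refine AH.mul (AH_pow ha (fun x : ZMod 3 × ZMod 3 × ZMod 3 => x.1) (fun _ _ => rfl))
      (AH.mul (AH_pow hb (fun x : ZMod 3 × ZMod 3 × ZMod 3 => x.2.1) (fun _ _ => rfl))
      (AH_pow hc (fun x : ZMod 3 × ZMod 3 × ZMod 3 => x.2.2) (fun _ _ => rfl))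
      (fun x y => Commute.pow_pow hbc _ _)) (fun x y => ?_)
    exact (Commute.pow_pow hab _ _).mul_right (Commute.pow_pow hac _ _)
  · rintro ⟨i, j, k⟩ h
    simp only at h
    have hi : i = 0 := by
      by_contra hi
      apply ia
      apply mem_of_pow3 ha hi
      rw [mul_eq_one_iff_eq_inv] at h
      rw [h]
      exact inv_mem (mul_mem (pow_mem (Subgroup.subset_closure (by simp)) _)
        (pow_mem (Subgroup.subset_closure (by simp)) _))
    subst hi
    rw [ZMod.val_zero, pow_zero, one_mul] at h
    have hj : j = 0 := by
      by_contra hj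
      apply ib
      apply mem_of_pow3 hb hj
      rw [mul_eq_one_iff_eq_inv] at h
      rw [h]
      exact inv_mem (pow_mem (Subgroup.mem_zpowers c) _)
    subst hj
    rw [ZMod.val_zero, pow_zero, one_mul] at h
    have hk : k = 0 := by
      by_contra hk
      apply ic
      have := mem_of_pow3 (M := ⊥) hc hk h
      exact this
    subst hk
    rfl
  · intro M hM
    apply hgen
    · simpa [v1] using hM (1, 0, 0)
    · simpa [v1] using hM (0, 1, 0)
    · simpa [v1] using hM (0, 0, 1)

lemma isoX {c u v : G} (hcu : c * u = u * c) (hcv : c * v = v * c) (huv : u * v = v * u)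
    (hc : c ^ 6 = 1) (hc2 : c ^ 2 ≠ 1) (hc3 : c ^ 3 ≠ 1) (hu : u ^ 2 = 1) (hv : v ^ 2 = 1)
    (iu : u ∉ Subgroup.closure {v, c}) (iv : v ∉ Subgroup.zpowers c)
    (hgen : ∀ M : Subgroup G, c ∈ M → u ∈ M → v ∈ M → M = ⊤) :
    Nonempty (G ≃* Multiplicative (ZMod 3 × (Fin 3 → ZMod 2))) := by
  have r3 : (c ^ 4) ^ 3 = 1 := by
    rw [← pow_mul, show 4 * 3 = 6 * 2 from rfl, pow_mul, hc, one_pow]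
  have w2 : (c ^ 3) ^ 2 = 1 := by rw [← pow_mul, hc]
  apply iso_of_AH (p := fun x : ZMod 3 × (Fin 3 → ZMod 2) =>
    u ^ (x.2 0).val * (v ^ (x.2 1).val * ((c ^ 4) ^ x.1.val * (c ^ 3) ^ (x.2 2).val)))
  · refine AH.mul (AH_pow hu (fun x : ZMod 3 × (Fin 3 → ZMod 2) => x.2 0) (fun _ _ => rfl))
      (AH.mul (AH_pow hv (fun x : ZMod 3 × (Fin 3 → ZMod 2) => x.2 1) (fun _ _ => rfl))
      (AH.mul (AH_pow r3 (fun x : ZMod 3 × (Fin 3 → ZMod 2) => x.1) (fun _ _ => rfl))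
        (AH_pow w2 (fun x : ZMod 3 × (Fin 3 → ZMod 2) => x.2 2) (fun _ _ => rfl)) ?_) ?_) ?_
    · intro x y
      exact Commute.pow_pow (Commute.pow_pow (Commute.refl c) _ _) _ _
    · intro x y
      exact (Commute.pow_pow (Commute.pow_right hcv.symm _) _ _).mul_right
        (Commute.pow_pow (Commute.pow_right hcv.symm _) _ _)
    · intro x y
      exact (Commute.pow_pow huv _ _).mul_right
        ((Commute.pow_pow (Commute.pow_right hcu.symm _) _ _).mul_right
        (Commute.pow_pow (Commute.pow_right hcu.symm _) _ _))
  · rintro ⟨i, f⟩ h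
    simp only at h
    have hmem : ∀ M : Subgroup G, c ∈ M → (c ^ 4) ^ i.val * (c ^ 3) ^ (f 2).val ∈ M := by
      intro M hM
      exact mul_mem (pow_mem (pow_mem hM _) _) (pow_mem (pow_mem hM _) _)
    have h0 : f 0 = 0 := by
      by_contra hi
      apply iu
      rw [val2 _ hi, pow_one, mul_eq_one_iff_eq_inv] at h
      rw [h]
      exact inv_mem (mul_mem (pow_mem (Subgroup.subset_closure (by simp)) _)
        (hmem _ (Subgroup.subset_closure (by simp))))
    rw [h0, ZMod.val_zero, pow_zero, one_mul] at h
    have h1 : f 1 = 0 := by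
      by_contra hi
      apply iv
      rw [val2 _ hi, pow_one, mul_eq_one_iff_eq_inv] at h
      rw [h]
      exact inv_mem (hmem _ (Subgroup.mem_zpowers c))
    rw [h1, ZMod.val_zero, pow_zero, one_mul] at h
    have h2 : f 2 = 0 := by
      by_contra hi
      rw [val2 _ hi, pow_one] at h
      have h3 := congrArg (· ^ 3) h
      beta_reduce at h3
      rw [((Commute.pow_pow (Commute.refl c) 4 3).pow_left _).mul_pow, ← pow_mul, mul_comm,
        pow_mul, r3, one_pow, one_mul, one_pow, ← pow_mul, show 3 * 3 = 6 + 3 from rfl, pow_add, hc,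
        one_mul] at h3
      exact hc3 h3
    rw [h2, ZMod.val_zero, pow_zero, mul_one] at h
    have h3 : i = 0 := by
      by_contra hi
      have := mem_of_pow3 (M := ⊥) r3 hi h
      apply hc2
      have h4 : c ^ 4 = 1 := this
      rw [← hc, show 6 = 4 + 2 from rfl, pow_add, h4, one_mul]
    subst h3
    ext j
    · rfl
    · fin_cases j
      · simpa using congrArg (fun x : ZMod 2 => x) h0
      · simpa using congrArg (fun x : ZMod 2 => x) h1
      · simpa using congrArg (fun x : ZMod 2 => x) h2
  · intro M hM
    apply hgen
    · have h1 := hM (1, 0)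
      have h2 := hM (0, ![0, 0, 1])
      have e1 : (ZMod.val (1 : ZMod 3)) = 1 := rfl
      have e2 : (ZMod.val (1 : ZMod 2)) = 1 := rfl
      simp only [Pi.zero_apply, ZMod.val_zero, pow_zero, one_mul, mul_one, e1, pow_one] at h1
      simp [e2] at h2
      have h3 := mul_mem h1 h2
      rwa [← pow_add, show 4 + 3 = 6 + 1 from rfl, pow_add, hc, one_mul, pow_one] at h3
    · have h2 := hM (0, ![1, 0, 0])
      have e2 : (ZMod.val (1 : ZMod 2)) = 1 := rfl
      simpa [e2] using h2
    · have h2 := hM (0, ![0, 1, 0])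
      have e2 : (ZMod.val (1 : ZMod 2)) = 1 := rfl
      simpa [e2] using h2

end ORR


namespace ORR

variable {G : Type*} [Group G]

/-- The map from the quaternion group. -/
def qfun (α β : G) : QuaternionGroup 2 → G
  | .a i => α ^ (i.val)
  | .xa i => β * α ^ (i.val)

lemma qfun_mul {α β : G} (h4 : α ^ 4 = 1) (hA : pA α β) (hs : β * β = α * α)
    (x y : QuaternionGroup 2) : qfun α β (x * y) = qfun α β x * qfun α β y := by
  have hp : ∀ i j : ZMod (2 * 2), α ^ (i + j).val = α ^ i.val * α ^ j.val :=
    AH_pow (A := ZMod (2 * 2)) (n := 2 * 2) h4 (fun x => x) (fun _ _ => rfl)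
  have hn : ∀ i j : ZMod (2 * 2), α ^ (i - j).val = (α ^ j.val)⁻¹ * α ^ i.val := by
    intro i j
    rw [eq_inv_mul_iff_mul_eq, ← hp]
    congr 2
    ring
  have h2 : α ^ (2 : ZMod (2 * 2)).val = β * β := by
    rw [hs, show (2 : ZMod (2 * 2)).val = 2 from rfl, pow_two]
  have hc : ∀ k : ℕ, α ^ k * β = β * (α ^ k)⁻¹ := by
    intro k
    have : SemiconjBy β α⁻¹ α := by
      rw [SemiconjBy, ← show α * β = β * α⁻¹ from hA]
    have := this.pow_right k
    rw [SemiconjBy, inv_pow] at this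
    exact this.symm
  rcases x with i | i <;> rcases y with j | j
  · exact hp i j
  · change β * α ^ (j - i).val = α ^ i.val * (β * α ^ j.val)
    rw [hn, ← mul_assoc, ← mul_assoc, hc]
  · change β * α ^ (i + j).val = β * α ^ i.val * α ^ j.val
    rw [hp, mul_assoc]
  · change α ^ (2 + j - i : ZMod (2 * 2)).val = β * α ^ i.val * (β * α ^ j.val)
    rw [show β * α ^ i.val * (β * α ^ j.val) = β * (α ^ i.val * β) * α ^ j.val by group, hc,
      ← mul_assoc, ← h2, mul_assoc, ← hn, ← hp]
    congr 2
    ring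

/-- The homomorphism from the quaternion group. -/
def qhom {α β : G} (h4 : α ^ 4 = 1) (hA : pA α β) (hs : β * β = α * α) : QuaternionGroup 2 →* G :=
  MonoidHom.mk' (qfun α β) (qfun_mul h4 hA hs)

lemma qhom_ker {α β : G} (h4 : α ^ 4 = 1) (hA : pA α β) (hs : β * β = α * α)
    (h2 : α ^ 2 ≠ 1) (hb : β ∉ Subgroup.zpowers α) (x : QuaternionGroup 2)
    (h : qhom h4 hA hs x = 1) : x = 1 := by
  rcases x with i | i
  · change α ^ i.val = 1 at h
    by_contra hi
    have : ∀ i : ZMod (2 * 2), i = 0 ∨ i.val = 1 ∨ i.val = 2 ∨ i.val = 3 := by decide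
    rcases this i with h' | h' | h' | h'
    · apply hi; rw [h']; rfl
    · rw [h', pow_one] at h
      apply h2; rw [h, one_pow]
    · rw [h'] at h
      exact h2 h
    · rw [h'] at h
      have : α = 1 := by rw [← h4, pow_succ, h, one_mul]
      apply h2; rw [this, one_pow]
  · change β * α ^ i.val = 1 at h
    rw [mul_eq_one_iff_eq_inv] at h
    exact absurd (h ▸ inv_mem (pow_mem (Subgroup.mem_zpowers α) _)) hb

lemma qhom_a {α β : G} (h4 : α ^ 4 = 1) (hA : pA α β) (hs : β * β = α * α) :
    qhom h4 hA hs (.a 1) = α := by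
  change α ^ (1 : ZMod (2 * 2)).val = α
  rw [show (1 : ZMod (2 * 2)).val = 1 from rfl, pow_one]

lemma qhom_b {α β : G} (h4 : α ^ 4 = 1) (hA : pA α β) (hs : β * β = α * α) :
    qhom h4 hA hs (.xa 0) = β := by
  change β * α ^ (0 : ZMod (2 * 2)).val = β
  rw [show (0 : ZMod (2 * 2)).val = 0 from rfl, pow_zero, mul_one]

lemma qfun_mem {α β : G} {M : Subgroup G} (ha : α ∈ M) (hb : β ∈ M) (x : QuaternionGroup 2) :
    qfun α β x ∈ M := by
  rcases x with i | i
  · exact pow_mem ha _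
  · exact mul_mem hb (pow_mem ha _)

lemma isoQ {α β : G} (h4 : α ^ 4 = 1) (hA : pA α β) (hs : β * β = α * α)
    (h2 : α ^ 2 ≠ 1) (hb : β ∉ Subgroup.zpowers α)
    (hgen : ∀ M : Subgroup G, α ∈ M → β ∈ M → M = ⊤) : Nonempty (G ≃* QuaternionGroup 2) := by
  refine ⟨(MulEquiv.ofBijective (qhom h4 hA hs) ⟨?_, ?_⟩).symm⟩
  · rw [injective_iff_map_eq_one]
    exact qhom_ker h4 hA hs h2 hb
  · rw [← MonoidHom.range_eq_top]
    apply hgen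
    · exact ⟨_, qhom_a h4 hA hs⟩
    · exact ⟨_, qhom_b h4 hA hs⟩

lemma isoQ2 {α β e : G} (h4 : α ^ 4 = 1) (hA : pA α β) (hs : β * β = α * α)
    (h2 : α ^ 2 ≠ 1) (hb : β ∉ Subgroup.zpowers α)
    (he : e ^ 2 = 1) (hea : α * e = e * α) (heb : β * e = e * β)
    (he' : e ∉ Subgroup.closure {α, β})
    (hgen : ∀ M : Subgroup G, α ∈ M → β ∈ M → e ∈ M → M = ⊤) :
    Nonempty (G ≃* QuaternionGroup 2 × Multiplicative (ZMod 2)) := by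
  have hcomm : ∀ x y, Commute (qfun α β x) (e ^ (y : ZMod 2).val) := by
    intro x y
    apply Commute.pow_right
    rcases x with i | i
    · exact Commute.pow_left hea _
    · exact Commute.mul_left heb (Commute.pow_left hea _)
  let f : QuaternionGroup 2 × Multiplicative (ZMod 2) →* G :=
    MonoidHom.mk' (fun x => qfun α β x.1 * e ^ (x.2.toAdd : ZMod 2).val) (by
      intro x y
      rw [Prod.fst_mul, Prod.snd_mul, qfun_mul h4 hA hs]
      have := AH_pow (A := ZMod 2) (n := 2) he (fun x => x) (fun _ _ => rfl) x.2.toAdd y.2.toAdd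
      simp only at this
      rw [toAdd_mul, this, mul_assoc, mul_assoc, ← mul_assoc (qfun α β y.1), (hcomm _ _).eq,
        mul_assoc])
  refine ⟨(MulEquiv.ofBijective f ⟨?_, ?_⟩).symm⟩
  · rw [injective_iff_map_eq_one]
    rintro ⟨x, y⟩ h
    change qfun α β x * e ^ (y.toAdd : ZMod 2).val = 1 at h
    have hy : y.toAdd = 0 := by
      by_contra hy
      apply he'
      rw [val2 _ hy, pow_one, mul_eq_one_iff_eq_inv'] at h
      rw [h]
      exact inv_mem (qfun_mem (Subgroup.subset_closure (by simp))
        (Subgroup.subset_closure (by simp)) x)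
    rw [hy, ZMod.val_zero, pow_zero, mul_one] at h
    have := qhom_ker h4 hA hs h2 hb x h
    rw [this]
    exact Prod.ext rfl hy
  · rw [← MonoidHom.range_eq_top]
    apply hgen
    · refine ⟨(.a 1, Multiplicative.ofAdd 0), ?_⟩
      change qhom h4 hA hs (.a 1) * e ^ (0 : ZMod 2).val = α
      rw [qhom_a, ZMod.val_zero, pow_zero, mul_one]
    · refine ⟨(.xa 0, Multiplicative.ofAdd 0), ?_⟩
      change qhom h4 hA hs (.xa 0) * e ^ (0 : ZMod 2).val = β
      rw [qhom_b, ZMod.val_zero, pow_zero, mul_one]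
    · refine ⟨(1, Multiplicative.ofAdd 1), ?_⟩
      change qhom h4 hA hs 1 * e ^ (1 : ZMod 2).val = e
      rw [map_one, one_mul, show (1 : ZMod 2).val = 1 from rfl, pow_one]

end ORR


namespace ORR

set_option linter.unusedSectionVars false

section
variable {G : Type*} [Group G] [Fintype G] [DecidableEq G]

/-- Out-neighbours of a set. -/
def oF (S X : Finset G) : Finset G := Finset.univ.filter (fun y => ∃ x ∈ X, y * x⁻¹ ∈ S)
/-- In-neighbours of a set. -/
def iF (S X : Finset G) : Finset G := Finset.univ.filter (fun y => ∃ x ∈ X, x * y⁻¹ ∈ S)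

/-- Sets invariant under the stabiliser of the identity. -/
def InvF (S X : Finset G) : Prop :=
  ∀ φ : Equiv.Perm G, IsCayleyAut (S : Set G) φ → φ 1 = 1 → ∀ x, x ∈ X ↔ φ x ∈ X

lemma invF_one (S : Finset G) : InvF S {1} := by
  intro φ _ h1 x
  simp only [Finset.mem_singleton]
  constructor
  · rintro rfl; exact h1
  · intro h; exact φ.injective (h.trans h1.symm)

lemma inv_diff {S X Y : Finset G} (hX : InvF S X) (hY : InvF S Y) : InvF S (X \ Y) := by
  intro φ h h1 x
  simp only [Finset.mem_sdiff]
  rw [hX φ h h1 x, hY φ h h1 x]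

lemma inv_inter {S X Y : Finset G} (hX : InvF S X) (hY : InvF S Y) : InvF S (X ∩ Y) := by
  intro φ h h1 x
  simp only [Finset.mem_inter]
  rw [hX φ h h1 x, hY φ h h1 x]

lemma inv_out {S X : Finset G} (hX : InvF S X) : InvF S (oF S X) := by
  intro φ h h1 y
  simp only [oF, Finset.mem_filter, Finset.mem_univ, true_and]
  constructor
  · rintro ⟨x, hx, hy⟩
    exact ⟨φ x, (hX φ h h1 x).1 hx, Finset.mem_coe.1 ((h x y).1 hy)⟩
  · rintro ⟨x, hx, hy⟩
    refine ⟨φ.symm x, (hX φ h h1 _).2 (by simpa using hx), ?_⟩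
    apply Finset.mem_coe.1 ((h _ y).2 _)
    simpa using hy

lemma inv_in {S X : Finset G} (hX : InvF S X) : InvF S (iF S X) := by
  intro φ h h1 y
  simp only [iF, Finset.mem_filter, Finset.mem_univ, true_and]
  constructor
  · rintro ⟨x, hx, hy⟩
    exact ⟨φ x, (hX φ h h1 x).1 hx, Finset.mem_coe.1 ((h y x).1 hy)⟩
  · rintro ⟨x, hx, hy⟩
    refine ⟨φ.symm x, (hX φ h h1 _).2 (by simpa using hx), ?_⟩
    apply Finset.mem_coe.1 ((h y _).2 _)
    simpa using hy

lemma fix_of_inv {S X : Finset G} {g : G} (hX : InvF S X) (h : X = {g}) :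
    g ∈ FixSub (S : Set G) := by
  rw [mem_fix]
  intro φ h1 h2
  have := (hX φ h1 h2 g).1 (by simp [h])
  simpa [h] using this

end

/-- Connection set for `Q8 × C2`. -/
def SQ : Finset (QuaternionGroup 2 × Multiplicative (ZMod 2)) :=
  {(.a 1, .ofAdd 0), (.a 3, .ofAdd 1), (.xa 2, .ofAdd 0), (.xa 1, .ofAdd 0)}

lemma orr_Q2 : HasORR (QuaternionGroup 2 × Multiplicative (ZMod 2)) := by
  have i1 := invF_one SQ
  have o1 := inv_out i1
  have oo1 := inv_out o1
  have in1 := inv_in i1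
  have io1 := inv_in o1
  have h1 := fix_of_inv (g := (.a 1, .ofAdd 1)) (inv_diff in1 oo1) (by decide +kernel)
  have h2 := fix_of_inv (g := (.a 2, .ofAdd 1)) (inv_diff (inv_diff io1 oo1) i1)
    (by decide +kernel)
  have h3 := fix_of_inv (g := (.xa 0, .ofAdd 1))
    (inv_inter (inv_out (inv_diff o1 oo1)) (inv_in (inv_diff oo1 io1))) (by decide +kernel)
  apply orr_of_fix (S := (SQ : Set _))
  · have : ∀ s ∈ SQ, s⁻¹ ∉ SQ := by decide +kernel
    exact this
  · rw [eq_top_iff]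
    intro x _
    have : ∀ x : QuaternionGroup 2 × Multiplicative (ZMod 2), ∃ i j k : Fin 4,
      x = (.a 1, .ofAdd 1) ^ i.val * (.a 2, .ofAdd 1) ^ j.val * (.xa 0, .ofAdd 1) ^ k.val := by
      decide +kernel
    obtain ⟨i, j, k, rfl⟩ := this x
    exact mul_mem (mul_mem (pow_mem h1 _) (pow_mem h2 _)) (pow_mem h3 _)

/-- Connection set for `C3 × C3 × C3`. -/
def SC : Finset (Multiplicative (ZMod 3 × ZMod 3 × ZMod 3)) :=
  {.ofAdd (0, 0, 1), .ofAdd (0, 1, 0), .ofAdd (0, 1, 1), .ofAdd (0, 1, 2), .ofAdd (1, 0, 0),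
    .ofAdd (1, 1, 0)}

lemma orr_C333 : HasORR (Multiplicative (ZMod 3 × ZMod 3 × ZMod 3)) := by
  have i1 := invF_one SC
  have o1 := inv_out i1
  have oo1 := inv_out o1
  have ii1 := inv_in (inv_in i1)
  have io1 := inv_in o1
  have h1 := fix_of_inv (g := .ofAdd (1, 1, 0)) (inv_diff o1 io1) (by decide +kernel)
  have h2 := fix_of_inv (g := .ofAdd (0, 0, 1)) (inv_diff o1 (inv_in (inv_diff ii1 o1)))
    (by decide +kernel)
  have h3 := fix_of_inv (g := .ofAdd (0, 1, 2))
    (inv_diff o1 (inv_in (inv_diff oo1 io1))) (by decide +kernel)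
  apply orr_of_fix (S := (SC : Set _))
  · have : ∀ s ∈ SC, s⁻¹ ∉ SC := by decide +kernel
    exact this
  · rw [eq_top_iff]
    intro x _
    have : ∀ x : Multiplicative (ZMod 3 × ZMod 3 × ZMod 3), ∃ i j k : Fin 3,
      x = .ofAdd (1, 1, 0) ^ i.val * .ofAdd (0, 0, 1) ^ j.val * .ofAdd (0, 1, 2) ^ k.val := by
      decide +kernel
    obtain ⟨i, j, k, rfl⟩ := this x
    exact mul_mem (mul_mem (pow_mem h1 _) (pow_mem h2 _)) (pow_mem h3 _)

end ORR


namespace ORR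

lemma no_orr {H : Type*} [Group H] [Finite H]
    (h : ∀ S : Set H, (∀ s ∈ S, s⁻¹ ∉ S) → ∃ f : H →* H, (∀ x, f x = 1 → x = 1) ∧
      (∃ x, f x ≠ x) ∧ ∀ x, f x ∈ S ↔ x ∈ S) : ¬ HasORR H := by
  rintro ⟨S, hS, hD⟩
  obtain ⟨f, h1, ⟨x, hx⟩, h3⟩ := h S (by
    intro s hs hs'
    have : s ∈ S ∩ S⁻¹ := ⟨hs, hs'⟩
    rw [hS] at this
    exact this)
  have hb : Function.Bijective f :=
    Finite.injective_iff_bijective.1 ((injective_iff_map_eq_one f).2 h1)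
  obtain ⟨g, hg⟩ := hD (Equiv.ofBijective f hb) (by
    intro x y
    simp only [Equiv.ofBijective_apply]
    rw [← map_inv, ← map_mul, h3])
  have h4 := hg 1
  simp only [Equiv.ofBijective_apply, map_one, one_mul] at h4
  have h5 := hg x
  rw [← h4, mul_one] at h5
  exact hx h5

lemma colour {H : Type*} [Group H] {S : Set H} (hS : ∀ s ∈ S, s⁻¹ ∉ S) (x y : H) (h : x⁻¹ = y) :
    ∃ c : Fin 3, (x ∈ S ↔ c = 1) ∧ (y ∈ S ↔ c = 2) := by
  subst h
  by_cases h1 : x ∈ S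
  · exact ⟨1, by simp [h1], by simp [hS x h1]⟩
  · by_cases h2 : x⁻¹ ∈ S
    · exact ⟨2, by simp [h1], by simp [h2]⟩
    · exact ⟨0, by simp [h1], by simp [h2]⟩

lemma invol {H : Type*} [Group H] {S : Set H} (hS : ∀ s ∈ S, s⁻¹ ∉ S) (x : H) (h : x⁻¹ = x) :
    x ∉ S := by
  intro h1
  apply hS x h1
  rwa [h]

/-- Membership table. -/
def tblQ (c1 c2 c3 : Fin 3) : QuaternionGroup 2 → Bool
  | .a i => bif i == 1 then c1 == 1 else bif i == 3 then c1 == 2 else false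
  | .xa i => bif i == 0 then c2 == 1 else bif i == 2 then c2 == 2 else
      bif i == 1 then c3 == 1 else c3 == 2

lemma keyQ : ∀ c1 c2 c3 : Fin 3, ∃ α β : QuaternionGroup 2,
    (α ^ 4 = 1 ∧ α * β = β * α⁻¹ ∧ β * β = α * α) ∧ (α ≠ .a 1 ∨ β ≠ .xa 0) ∧
    (∀ x, qfun α β x = 1 → x = 1) ∧ ∀ x, tblQ c1 c2 c3 (qfun α β x) = tblQ c1 c2 c3 x := by
  decide +kernel

lemma no_Q : ¬ HasORR (QuaternionGroup 2) := by
  have : Finite (QuaternionGroup 2) := Finite.of_fintype _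
  apply no_orr
  intro S hS
  obtain ⟨c1, a1, a2⟩ := colour hS (.a 1) (.a 3) (by decide)
  obtain ⟨c2, b1, b2⟩ := colour hS (.xa 0) (.xa 2) (by decide)
  obtain ⟨c3, d1, d2⟩ := colour hS (.xa 1) (.xa 3) (by decide)
  have e0 := invol hS (.a 0) (by decide)
  have e2 := invol hS (.a 2) (by decide)
  have ht : ∀ x, x ∈ S ↔ tblQ c1 c2 c3 x = true := by
    have h4 : ∀ i : ZMod (2 * 2), i = 0 ∨ i = 1 ∨ i = 2 ∨ i = 3 := by decide
    rintro (i | i) <;> rcases h4 i with rfl | rfl | rfl | rfl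
    · exact iff_of_false e0 (by clear * -; revert c1 c2 c3; decide +kernel)
    · rw [a1]; clear * -; revert c1 c2 c3; decide +kernel
    · exact iff_of_false e2 (by clear * -; revert c1 c2 c3; decide +kernel)
    · rw [a2]; clear * -; revert c1 c2 c3; decide +kernel
    · rw [b1]; clear * -; revert c1 c2 c3; decide +kernel
    · rw [d1]; clear * -; revert c1 c2 c3; decide +kernel
    · rw [b2]; clear * -; revert c1 c2 c3; decide +kernel
    · rw [d2]; clear * -; revert c1 c2 c3; decide +kernel
  obtain ⟨α, β, ⟨h4, hA, hs⟩, hne, hk, hf⟩ := keyQ c1 c2 c3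
  have hA : pA α β := hA
  refine ⟨qhom h4 hA hs, hk, ?_, ?_⟩
  · rcases hne with h | h
    · exact ⟨.a 1, by rwa [qhom_a]⟩
    · exact ⟨.xa 0, by rwa [qhom_b]⟩
  · intro x
    rw [ht, ht]
    exact Iff.of_eq (congrArg (· = true) (hf x))

/-- Membership table. -/
def tbl3 (c1 c2 c3 c4 : Fin 3) (x : ZMod 3 × ZMod 3) : Bool :=
  bif x == (1, 0) then c1 == 1 else bif x == (2, 0) then c1 == 2 else
  bif x == (0, 1) then c2 == 1 else bif x == (0, 2) then c2 == 2 else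
  bif x == (1, 1) then c3 == 1 else bif x == (2, 2) then c3 == 2 else
  bif x == (1, 2) then c4 == 1 else bif x == (2, 1) then c4 == 2 else false

/-- A linear map. -/
def lin3 (a b c d : ZMod 3) (x : ZMod 3 × ZMod 3) : ZMod 3 × ZMod 3 :=
  (a * x.1 + b * x.2, c * x.1 + d * x.2)

lemma key3 : ∀ c1 c2 c3 c4 : Fin 3, ∃ a b c d : ZMod 3, ¬ (a = 1 ∧ b = 0 ∧ c = 0 ∧ d = 1) ∧
    (a * d ≠ b * c) ∧ ∀ x, tbl3 c1 c2 c3 c4 (lin3 a b c d x) = tbl3 c1 c2 c3 c4 x := by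
  decide +kernel

lemma lin3_inj : ∀ a b c d : ZMod 3, a * d ≠ b * c → ∀ x, lin3 a b c d x = 0 → x = 0 := by
  decide +kernel

lemma no_33 : ¬ HasORR (Multiplicative (ZMod 3 × ZMod 3)) := by
  apply no_orr
  intro S hS
  obtain ⟨c1, a1, a2⟩ := colour hS (.ofAdd (1, 0)) (.ofAdd (2, 0)) (by decide)
  obtain ⟨c2, b1, b2⟩ := colour hS (.ofAdd (0, 1)) (.ofAdd (0, 2)) (by decide)
  obtain ⟨c3, d1, d2⟩ := colour hS (.ofAdd (1, 1)) (.ofAdd (2, 2)) (by decide)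
  obtain ⟨c4, f1, f2⟩ := colour hS (.ofAdd (1, 2)) (.ofAdd (2, 1)) (by decide)
  have e0 := invol hS (.ofAdd (0, 0)) (by decide)
  have ht : ∀ x, Multiplicative.ofAdd x ∈ S ↔ tbl3 c1 c2 c3 c4 x = true := by
    have h4 : ∀ i : ZMod 3, i = 0 ∨ i = 1 ∨ i = 2 := by decide
    rintro ⟨i, j⟩
    rcases h4 i with rfl | rfl | rfl <;> rcases h4 j with rfl | rfl | rfl
    · exact iff_of_false e0 (by clear * -; revert c1 c2 c3 c4; decide +kernel)
    · rw [b1]; clear * -; revert c1 c2 c3 c4; decide +kernel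
    · rw [b2]; clear * -; revert c1 c2 c3 c4; decide +kernel
    · rw [a1]; clear * -; revert c1 c2 c3 c4; decide +kernel
    · rw [d1]; clear * -; revert c1 c2 c3 c4; decide +kernel
    · rw [f1]; clear * -; revert c1 c2 c3 c4; decide +kernel
    · rw [a2]; clear * -; revert c1 c2 c3 c4; decide +kernel
    · rw [f2]; clear * -; revert c1 c2 c3 c4; decide +kernel
    · rw [d2]; clear * -; revert c1 c2 c3 c4; decide +kernel
  obtain ⟨a, b, c, d, hne, hdet, hf⟩ := key3 c1 c2 c3 c4
  refine ⟨MonoidHom.mk' (fun x => .ofAdd (lin3 a b c d x.toAdd)) ?_, ?_, ?_, ?_⟩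
  · intro x y
    change Multiplicative.ofAdd _ = Multiplicative.ofAdd (_ + _)
    congr 1
    unfold lin3
    ext
    · simp; ring
    · simp; ring
  · intro x hx
    exact lin3_inj a b c d hdet _ hx
  · by_contra hall
    push Not at hall
    have h1 : lin3 a b c d (1, 0) = (1, 0) := hall (.ofAdd (1, 0))
    have h2 : lin3 a b c d (0, 1) = (0, 1) := hall (.ofAdd (0, 1))
    simp [lin3] at h1 h2
    exact hne ⟨h1.1, h2.1, h1.2, h2.2⟩
  · intro x
    have h1 := ht (lin3 a b c d x.toAdd)
    have h2 := ht x.toAdd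
    rw [hf x.toAdd, ← h2] at h1
    exact h1

end ORR


namespace ORR

/-- A transvection. -/
def trv (p l v : Fin 3 → ZMod 2) : Fin 3 → ZMod 2 := v + (l 0 * v 0 + l 1 * v 1 + l 2 * v 2) • p

lemma trv_add (p l u v : Fin 3 → ZMod 2) : trv p l (u + v) = trv p l u + trv p l v := by
  unfold trv
  ext i
  simp only [Pi.add_apply, Pi.smul_apply, smul_eq_mul]
  ring

/-- What we want from a transvection. -/
def TrvOK (k : (Fin 3 → ZMod 2) → Fin 3) : Prop :=
  ∃ p l : Fin 3 → ZMod 2, (∃ v, trv p l v ≠ v) ∧ (∀ v, trv p l v = 0 → v = 0) ∧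
    ∀ v, k (trv p l v) = k v

lemma trv_ok {k : (Fin 3 → ZMod 2) → Fin 3} (p l x1 y1 x2 y2 : Fin 3 → ZMod 2)
    (h : ∀ v, trv p l v = v ∨ (v = x1 ∧ trv p l v = y1) ∨ (v = y1 ∧ trv p l v = x1) ∨
      (v = x2 ∧ trv p l v = y2) ∨ (v = y2 ∧ trv p l v = x2))
    (h0 : ∀ v, trv p l v = 0 → v = 0) (h1 : trv p l x1 ≠ x1)
    (hk : k x1 = k y1 ∧ k x2 = k y2) : TrvOK k := by
  refine ⟨p, l, ⟨x1, h1⟩, h0, ?_⟩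
  intro v
  rcases h v with e | ⟨e, f⟩ | ⟨e, f⟩ | ⟨e, f⟩ | ⟨e, f⟩
  · rw [e]
  · rw [f, e, hk.1]
  · rw [f, e, hk.1]
  · rw [f, e, hk.2]
  · rw [f, e, hk.2]

lemma keyT : ∀ c1 c2 c3 c4 c5 c6 c7 : Fin 3,
    (c2 = c3 ∧ c6 = c7) ∨
    (c4 = c5 ∧ c6 = c7) ∨
    (c2 = c3 ∧ c4 = c5) ∨
    (c1 = c3 ∧ c5 = c7) ∨
    (c4 = c6 ∧ c5 = c7) ∨
    (c1 = c3 ∧ c4 = c6) ∨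
    (c1 = c2 ∧ c5 = c6) ∨
    (c4 = c7 ∧ c5 = c6) ∨
    (c1 = c2 ∧ c4 = c7) ∨
    (c1 = c5 ∧ c3 = c7) ∨
    (c2 = c6 ∧ c3 = c7) ∨
    (c1 = c5 ∧ c2 = c6) ∨
    (c2 = c7 ∧ c3 = c6) ∨
    (c1 = c4 ∧ c3 = c6) ∨
    (c1 = c4 ∧ c2 = c7) ∨
    (c1 = c7 ∧ c3 = c5) ∨
    (c2 = c4 ∧ c3 = c5) ∨
    (c1 = c7 ∧ c2 = c4) ∨
    (c1 = c6 ∧ c2 = c5) ∨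
    (c1 = c6 ∧ c3 = c4) ∨
    (c2 = c5 ∧ c3 = c4) := by
  decide +kernel

lemma trv_exists (k : (Fin 3 → ZMod 2) → Fin 3) : TrvOK k := by
  rcases keyT (k ![0, 0, 1]) (k ![0, 1, 0]) (k ![0, 1, 1]) (k ![1, 0, 0]) (k ![1, 0, 1]) (k ![1, 1, 0]) (k ![1, 1, 1]) with
    h | h | h | h | h | h | h | h | h | h | h | h | h | h | h | h | h | h | h | h | h
  · exact trv_ok ![0, 0, 1] ![0, 1, 0] ![0, 1, 0] ![0, 1, 1] ![1, 1, 0] ![1, 1, 1]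
      (by decide +kernel) (by decide +kernel) (by decide +kernel) h
  · exact trv_ok ![0, 0, 1] ![1, 0, 0] ![1, 0, 0] ![1, 0, 1] ![1, 1, 0] ![1, 1, 1]
      (by decide +kernel) (by decide +kernel) (by decide +kernel) h
  · exact trv_ok ![0, 0, 1] ![1, 1, 0] ![0, 1, 0] ![0, 1, 1] ![1, 0, 0] ![1, 0, 1]
      (by decide +kernel) (by decide +kernel) (by decide +kernel) h
  · exact trv_ok ![0, 1, 0] ![0, 0, 1] ![0, 0, 1] ![0, 1, 1] ![1, 0, 1] ![1, 1, 1]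
      (by decide +kernel) (by decide +kernel) (by decide +kernel) h
  · exact trv_ok ![0, 1, 0] ![1, 0, 0] ![1, 0, 0] ![1, 1, 0] ![1, 0, 1] ![1, 1, 1]
      (by decide +kernel) (by decide +kernel) (by decide +kernel) h
  · exact trv_ok ![0, 1, 0] ![1, 0, 1] ![0, 0, 1] ![0, 1, 1] ![1, 0, 0] ![1, 1, 0]
      (by decide +kernel) (by decide +kernel) (by decide +kernel) h
  · exact trv_ok ![0, 1, 1] ![0, 1, 1] ![0, 0, 1] ![0, 1, 0] ![1, 0, 1] ![1, 1, 0]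
      (by decide +kernel) (by decide +kernel) (by decide +kernel) h
  · exact trv_ok ![0, 1, 1] ![1, 0, 0] ![1, 0, 0] ![1, 1, 1] ![1, 0, 1] ![1, 1, 0]
      (by decide +kernel) (by decide +kernel) (by decide +kernel) h
  · exact trv_ok ![0, 1, 1] ![1, 1, 1] ![0, 0, 1] ![0, 1, 0] ![1, 0, 0] ![1, 1, 1]
      (by decide +kernel) (by decide +kernel) (by decide +kernel) h
  · exact trv_ok ![1, 0, 0] ![0, 0, 1] ![0, 0, 1] ![1, 0, 1] ![0, 1, 1] ![1, 1, 1]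
      (by decide +kernel) (by decide +kernel) (by decide +kernel) h
  · exact trv_ok ![1, 0, 0] ![0, 1, 0] ![0, 1, 0] ![1, 1, 0] ![0, 1, 1] ![1, 1, 1]
      (by decide +kernel) (by decide +kernel) (by decide +kernel) h
  · exact trv_ok ![1, 0, 0] ![0, 1, 1] ![0, 0, 1] ![1, 0, 1] ![0, 1, 0] ![1, 1, 0]
      (by decide +kernel) (by decide +kernel) (by decide +kernel) h
  · exact trv_ok ![1, 0, 1] ![0, 1, 0] ![0, 1, 0] ![1, 1, 1] ![0, 1, 1] ![1, 1, 0]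
      (by decide +kernel) (by decide +kernel) (by decide +kernel) h
  · exact trv_ok ![1, 0, 1] ![1, 0, 1] ![0, 0, 1] ![1, 0, 0] ![0, 1, 1] ![1, 1, 0]
      (by decide +kernel) (by decide +kernel) (by decide +kernel) h
  · exact trv_ok ![1, 0, 1] ![1, 1, 1] ![0, 0, 1] ![1, 0, 0] ![0, 1, 0] ![1, 1, 1]
      (by decide +kernel) (by decide +kernel) (by decide +kernel) h
  · exact trv_ok ![1, 1, 0] ![0, 0, 1] ![0, 0, 1] ![1, 1, 1] ![0, 1, 1] ![1, 0, 1]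
      (by decide +kernel) (by decide +kernel) (by decide +kernel) h
  · exact trv_ok ![1, 1, 0] ![1, 1, 0] ![0, 1, 0] ![1, 0, 0] ![0, 1, 1] ![1, 0, 1]
      (by decide +kernel) (by decide +kernel) (by decide +kernel) h
  · exact trv_ok ![1, 1, 0] ![1, 1, 1] ![0, 0, 1] ![1, 1, 1] ![0, 1, 0] ![1, 0, 0]
      (by decide +kernel) (by decide +kernel) (by decide +kernel) h
  · exact trv_ok ![1, 1, 1] ![0, 1, 1] ![0, 0, 1] ![1, 1, 0] ![0, 1, 0] ![1, 0, 1]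
      (by decide +kernel) (by decide +kernel) (by decide +kernel) h
  · exact trv_ok ![1, 1, 1] ![1, 0, 1] ![0, 0, 1] ![1, 1, 0] ![0, 1, 1] ![1, 0, 0]
      (by decide +kernel) (by decide +kernel) (by decide +kernel) h
  · exact trv_ok ![1, 1, 1] ![1, 1, 0] ![0, 1, 0] ![1, 0, 1] ![0, 1, 1] ![1, 0, 0]
      (by decide +kernel) (by decide +kernel) (by decide +kernel) h

lemma no_X : ¬ HasORR (Multiplicative (ZMod 3 × (Fin 3 → ZMod 2))) := by
  apply no_orr
  intro S hS
  have h2 : ∀ v : Fin 3 → ZMod 2, -v = v := by decide +kernel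
  have hc : ∀ v : Fin 3 → ZMod 2, ∃ c : Fin 3, (Multiplicative.ofAdd ((1, v) : ZMod 3 × _) ∈ S ↔ c = 1) ∧
      (Multiplicative.ofAdd ((2, v) : ZMod 3 × _) ∈ S ↔ c = 2) := by
    intro v
    apply colour hS
    change Multiplicative.ofAdd (-1, -v) = _
    rw [h2]
    rfl
  have h0 : ∀ v : Fin 3 → ZMod 2, Multiplicative.ofAdd ((0, v) : ZMod 3 × _) ∉ S := by
    intro v
    apply invol hS
    change Multiplicative.ofAdd (-0, -v) = _
    rw [h2]
    rfl
  choose k hk1 hk2 using hc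
  obtain ⟨p, l, ⟨v, hv⟩, hker, hk⟩ := trv_exists k
  refine ⟨MonoidHom.mk' (fun x => .ofAdd (x.toAdd.1, trv p l x.toAdd.2)) ?_, ?_, ?_, ?_⟩
  · intro x y
    change Multiplicative.ofAdd _ = Multiplicative.ofAdd (_ + _)
    congr 1
    rw [toAdd_mul, Prod.snd_add, trv_add]
    rfl
  · intro x hx
    have h1 : (x.toAdd.1, trv p l x.toAdd.2) = (0, 0) := hx
    rw [Prod.mk.injEq] at h1
    exact Prod.ext h1.1 (hker _ h1.2)
  · refine ⟨.ofAdd (0, v), ?_⟩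
    intro h
    have h1 : (((0 : ZMod 3), trv p l v) : ZMod 3 × (Fin 3 → ZMod 2)) = (0, v) := h
    rw [Prod.mk.injEq] at h1
    exact hv h1.2
  · intro x
    obtain ⟨i, w⟩ := x
    change Multiplicative.ofAdd (i, trv p l w) ∈ S ↔ Multiplicative.ofAdd (i, w) ∈ S
    have h4 : ∀ i : ZMod 3, i = 0 ∨ i = 1 ∨ i = 2 := by decide
    rcases h4 i with rfl | rfl | rfl
    · exact iff_of_false (h0 _) (h0 _)
    · rw [hk1, hk1, hk]
    · rw [hk2, hk2, hk]

end ORR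


namespace ORR

variable {G : Type*} [Group G]

lemma orr_cyclic {h : G} (h2 : h * h ≠ 1) (hgen : ∀ M : Subgroup G, h ∈ M → M = ⊤) : HasORR G := by
  apply orr_of_closure (S := {h}) (T := {h})
  · rintro s rfl hs
    exact h2 (mul_eq_one_iff_eq_inv.2 hs.symm)
  · exact hgen _ (Subgroup.subset_closure rfl)
  · rintro t rfl
    rw [mem_fix]
    intro φ h1 h3
    exact (aut_mem h1 h3 t).2 rfl

lemma orr_trivial (hgen : ∀ M : Subgroup G, M = ⊤) : HasORR G :=
  orr_of_fix (S := ∅) (fun _ h => h.elim) (hgen _)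

lemma q8facts {p q : G} (hA : pA p q) (hs : p * p = q * q) : p ^ 4 = 1 ∧ pA q p := by
  have h1 : p * q * p = q := by rw [show p * q = q * p⁻¹ from hA, inv_mul_cancel_right]
  have h2 : q * p = p⁻¹ * q := by
    rw [eq_inv_mul_iff_mul_eq, ← mul_assoc, h1]
  have h3 : p * p * q = q * (p * p) := by rw [hs, mul_assoc]
  have h4 : p * p * q = q * (p⁻¹ * p⁻¹) := by
    rw [mul_assoc, show p * q = q * p⁻¹ from hA, ← mul_assoc, show p * q = q * p⁻¹ from hA, mul_assoc]
  have h5 : p * p = p⁻¹ * p⁻¹ := by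
    rw [h3] at h4
    exact mul_left_cancel h4
  constructor
  · rw [show p ^ 4 = (p * p) * (p * p) by simp [pow_succ, mul_assoc]]
    nth_rewrite 1 [h5]
    group
  · change q * p = p * q⁻¹
    rw [h2, inv_mul_eq_iff_eq_mul, ← mul_assoc, hs, mul_inv_cancel_right]

lemma two {x : ℕ → G} (h : PD0 x 2 0) (hg : Subgroup.closure {g | ∃ j < 2, x j = g} = ⊤) :
    HasORR G ∨ Nonempty (G ≃* QuaternionGroup 2) ∨
      Nonempty (G ≃* Multiplicative (ZMod 3 × ZMod 3)) := by
  have hgen : ∀ M : Subgroup G, x 0 ∈ M → x 1 ∈ M → M = ⊤ := by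
    intro M h0 h1
    rw [eq_top_iff, ← hg, Subgroup.closure_le]
    rintro _ ⟨j, hj, rfl⟩
    interval_cases j
    · exact h0
    · exact h1
  have ia : x 0 ∉ Subgroup.zpowers (x 1) := fun h' => h.irr 0 (by norm_num) (by
    refine Subgroup.zpowers_le.2 ?_ h'
    exact Subgroup.subset_closure ⟨1, by norm_num, by norm_num, rfl⟩)
  have ib : x 1 ∉ Subgroup.zpowers (x 0) := fun h' => h.irr 1 (by norm_num) (by
    refine Subgroup.zpowers_le.2 ?_ h'
    exact Subgroup.subset_closure ⟨0, by norm_num, by norm_num, rfl⟩)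
  have sa := h.sq 0 (by norm_num)
  have sb := h.sq 1 (by norm_num)
  have hd : x 1 * (x 0)⁻¹ * (x 1 * (x 0)⁻¹) ≠ 1 := h.hsq 0 le_rfl (by norm_num)
  by_cases hB : x 0 * x 1 = x 1 * x 0
  swap
  · by_cases hAC : pA (x 0) (x 1) ∧ x 0 * x 0 = x 1 * x 1
    · right; left
      exact isoQ (q8facts hAC.1 hAC.2).1 hAC.1 hAC.2.symm (by rwa [pow_two]) ib hgen
    · left
      exact good0 h (by norm_num) hg hB hAC
  generalize x 0 = a at *
  generalize x 1 = b at *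
  have a1 : a ≠ 1 := fun h => sa (by rw [h, one_mul])
  have b1 : b ≠ 1 := fun h => sb (by rw [h, one_mul])
  have big : ∀ c : G, c * c ≠ 1 → c ^ 3 ≠ 1 → c ^ 4 ≠ 1 →
      ∀ k : ℤ, 1 ≤ k → k ≤ 4 → c ^ k ≠ 1 := by
    intro c c2 c3 c4 k k1 k2
    interval_cases k
    · rw [zpow_one]
      intro h
      exact c2 (by rw [h, one_mul])
    · rwa [zpow_ofNat, pow_two]
    · rwa [zpow_ofNat]
    · rwa [zpow_ofNat]
  have c34 : ∀ b c : G, c * b = b * c → c * b⁻¹ * (c * b⁻¹) ≠ 1 → b ^ 3 = 1 → c ^ 4 = 1 →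
      (∀ M : Subgroup G, b ∈ M → c ∈ M → M = ⊤) → HasORR G := by
    intro b c hC hd h3 h4 hgen
    have hC : Commute c b⁻¹ := Commute.inv_right hC
    have e4 : (c * b⁻¹) ^ 4 = b⁻¹ := by
      rw [hC.mul_pow, h4, one_mul, inv_pow, show 4 = 3 + 1 from rfl, pow_add, h3, one_mul, pow_one]
    have e9 : (c * b⁻¹) ^ 9 = c := by
      rw [hC.mul_pow, inv_pow, show b ^ 9 = (b ^ 3) ^ 3 by rw [← pow_mul], h3,
        show 9 = 4 * 2 + 1 from rfl, pow_add, pow_mul, h4]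
      simp
    apply orr_cyclic hd
    intro M hM
    apply hgen
    · have := pow_mem hM 4
      rw [e4] at this
      exact inv_mem_iff.1 this
    · have := pow_mem hM 9
      rwa [e9] at this
  by_cases hb : b ^ 3 ≠ 1 ∧ b ^ 4 ≠ 1
  · exact Or.inl (L1 (big b sb hb.1 hb.2) ia sa hgen)
  by_cases ha : a ^ 3 ≠ 1 ∧ a ^ 4 ≠ 1
  · exact Or.inl (L1 (big a sa ha.1 ha.2) ib sb (fun M h1 h2 => hgen M h2 h1))
  by_cases ha3 : a ^ 3 = 1
  · by_cases hb3 : b ^ 3 = 1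
    · right; right
      exact iso33 hB ha3 hb3 b1 ia hgen
    · left
      exact c34 a b hB.symm hd ha3 (by tauto) hgen
  · have ha4 : a ^ 4 = 1 := by tauto
    left
    have hd' : a * b⁻¹ * (a * b⁻¹) ≠ 1 := by
      intro h
      apply hd
      have := congrArg (·⁻¹) h
      simpa [mul_assoc] using this
    by_cases hb3 : b ^ 3 = 1
    · exact c34 b a hB hd' hb3 ha4 (fun M h1 h2 => hgen M h2 h1)
    · have hb4 : b ^ 4 = 1 := by tauto
      obtain ⟨e1, e2⟩ := cp_44_aux hB.symm sb sa hd' hb4 ha4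
      exact L3' hB.symm e1 ib e2 (fun M h1 h2 => hgen M h2 h1)

end ORR


namespace ORR

variable {G : Type*} [Group G]

/-- Irredundant generating triples without involutions. -/
structure Tri (p q r : G) : Prop where
  ip : p ∉ Subgroup.closure {q, r}
  iq : q ∉ Subgroup.closure {p, r}
  ir : r ∉ Subgroup.closure {p, q}
  sp : p * p ≠ 1
  sq : q * q ≠ 1
  sr : r * r ≠ 1
  gen : ∀ M : Subgroup G, p ∈ M → q ∈ M → r ∈ M → M = ⊤

lemma Tri.swap12 {p q r : G} (h : Tri p q r) : Tri q p r :=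
  ⟨h.iq, h.ip, by rw [Set.pair_comm]; exact h.ir, h.sq, h.sp, h.sr, fun M h1 h2 => h.gen M h2 h1⟩

lemma Tri.swap23 {p q r : G} (h : Tri p q r) : Tri p r q :=
  ⟨by rw [Set.pair_comm]; exact h.ip, h.ir, h.iq, h.sp, h.sr, h.sq,
    fun M h1 h2 h3 => h.gen M h1 h3 h2⟩

lemma cl_inv (p r : G) : Subgroup.closure {p, r⁻¹} ≤ Subgroup.closure {p, r} := by
  rw [Subgroup.closure_le]
  rintro x (rfl | rfl)
  · exact Subgroup.subset_closure (by simp)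
  · exact inv_mem (Subgroup.subset_closure (by simp))

lemma Tri.inv3 {p q r : G} (h : Tri p q r) : Tri p q r⁻¹ := by
  refine ⟨fun h' => h.ip (cl_inv _ _ h'), fun h' => h.iq (cl_inv _ _ h'),
    fun h' => h.ir (inv_mem_iff.1 h'), h.sp, h.sq, ?_,
    fun M h1 h2 h3 => h.gen M h1 h2 (inv_mem_iff.1 h3)⟩
  intro h1
  apply h.sr
  have := congrArg (·⁻¹) h1
  simpa using this

lemma good1' {p q r : G} (h : Tri p q r) (hd : (r * q⁻¹) * (r * q⁻¹) ≠ 1) (hB : q * r ≠ r * q)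
    (hAC : ¬ (pA q r ∧ q * q = r * r)) : HasORR G := by
  let x : ℕ → G := fun n => if n = 0 then p else if n = 1 then q else r
  apply good1 (x := x) _ _ hB hAC
  · refine ⟨fun k => Or.inl ⟨rfl, rfl⟩, ?_, ?_, ?_⟩
    · intro i hi h'
      interval_cases i
      · apply h.ip
        refine (Subgroup.closure_le _).2 ?_ h'
        rintro _ ⟨j, hj, hji, rfl⟩
        interval_cases j
        · exact absurd rfl hji
        · exact Subgroup.subset_closure (by simp [x])
        · exact Subgroup.subset_closure (by simp [x])
      · apply h.iq
        refine (Subgroup.closure_le _).2 ?_ h'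
        rintro _ ⟨j, hj, hji, rfl⟩
        interval_cases j
        · exact Subgroup.subset_closure (by simp [x])
        · exact absurd rfl hji
        · exact Subgroup.subset_closure (by simp [x])
      · apply h.ir
        refine (Subgroup.closure_le _).2 ?_ h'
        rintro _ ⟨j, hj, hji, rfl⟩
        interval_cases j
        · exact Subgroup.subset_closure (by simp [x])
        · exact Subgroup.subset_closure (by simp [x])
        · exact absurd rfl hji
    · intro i hi
      interval_cases i
      · exact h.sp
      · exact h.sq
      · exact h.sr
    · intro k h1 h2
      have : k = 1 := by omega
      subst this
      exact hd
  · apply h.gen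
    · exact Subgroup.subset_closure ⟨0, by norm_num, rfl⟩
    · exact Subgroup.subset_closure ⟨1, by norm_num, rfl⟩
    · exact Subgroup.subset_closure ⟨2, by norm_num, rfl⟩

lemma zp_le1 (p q : G) : Subgroup.zpowers p ≤ Subgroup.closure {p, q} :=
  Subgroup.zpowers_le.2 (Subgroup.subset_closure (by simp))
lemma zp_le2 (p q : G) : Subgroup.zpowers q ≤ Subgroup.closure {p, q} :=
  Subgroup.zpowers_le.2 (Subgroup.subset_closure (by simp))

/-- equal squares and an involution quotient force commuting -/
lemma comm_of_sq {a b : G} (hs : a * a = b * b) (h : b * a⁻¹ * (b * a⁻¹) = 1) : a * b = b * a := by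
  have h1 : b * a⁻¹ = a * b⁻¹ := by
    rw [mul_eq_one_iff_eq_inv] at h
    rw [h]; group
  have h2 : b * a⁻¹ * (a * a) = a * b⁻¹ * (b * b) := by rw [h1, hs]
  have h3 : b * a⁻¹ * (a * a) = b * a := by group
  have h4 : a * b⁻¹ * (b * b) = a * b := by group
  rw [h3, h4] at h2
  exact h2.symm

lemma case_T {a c b : G} (h : Tri a c b) (hac : a * c = c * a) (hcb : c * b = b * c)
    (ha : a ^ 3 = 1) (hb : b ^ 3 = 1) (hc : c ^ 3 = 1) : HasORR G := by
  by_cases hab : a * b = b * a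
  · have c1 : c ≠ 1 := fun h' => h.sq (by rw [h', one_mul])
    obtain ⟨e⟩ := iso333 hab hac hcb.symm ha hb hc h.swap23.ip
      (fun h' => h.ir (zp_le2 _ _ h')) c1 (fun M h1 h2 h3 => h.gen M h1 h3 h2)
    exact orr_transfer e.symm orr_C333
  have hT : Tri c a b := h.swap12
  have ha' : a⁻¹ = a * a := by
    rw [inv_eq_iff_mul_eq_one, ← ha]; simp [pow_succ, mul_assoc]
  have hb' : b⁻¹ = b * b := by
    rw [inv_eq_iff_mul_eq_one, ← hb]; simp [pow_succ, mul_assoc]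
  by_cases hd : b * a⁻¹ * (b * a⁻¹) = 1
  swap
  · apply good1' hT hd hab
    rintro ⟨_, hs⟩
    rw [← ha', ← hb', inv_inj] at hs
    exact hab (by rw [hs])
  by_cases hd' : b⁻¹ * a⁻¹ * (b⁻¹ * a⁻¹) = 1
  swap
  · apply good1' hT.inv3 hd'
    · intro h'
      apply hab
      have : Commute a b⁻¹ := h'
      exact (Commute.inv_right_iff.1 this).eq
    · rintro ⟨_, hs⟩
      rw [hb', ← ha', show b * b * (b * b) = b by
        rw [← hb', ← mul_inv_rev, ← hb', inv_inv]] at hs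
      apply hab
      rw [← hs, inv_mul_cancel, mul_inv_cancel]
  exfalso
  have e1 : a * b * a = b⁻¹ := by
    have : a * b * (a * b) = 1 := by
      have := congrArg (·⁻¹) hd'
      simpa [mul_assoc] using this
    rw [eq_inv_iff_mul_eq_one, ← this]; group
  have e2 : a⁻¹ * b * a⁻¹ = b⁻¹ := by
    rw [eq_inv_iff_mul_eq_one]
    have h1 : b * (a⁻¹ * b * a⁻¹) = 1 := by rw [← hd]; group
    exact mul_eq_one_comm.1 h1
  have e3 : a * b * a = b := by
    have : a * b * a = a⁻¹ * b * a⁻¹ := by rw [e1, e2]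
    calc a * b * a = a⁻¹ * (a * a) * b * (a * a) * a⁻¹ := by group
      _ = a⁻¹ * (a⁻¹ * b * a⁻¹) * a⁻¹ := by rw [← ha']; group
      _ = a⁻¹ * (a * b * a) * a⁻¹ := by rw [this]
      _ = b := by group
  rw [e1, hb'] at e3
  exact h.sr (by rw [e3]; rw [mul_eq_left] at e3; exact e3)

end ORR


namespace ORR

variable {G : Type*} [Group G]

lemma case_X {a c b : G} (h : Tri a c b) (hac : a * c = c * a) (hcb : c * b = b * c)
    (ha : a ^ 6 = 1) (hb : b ^ 6 = 1) (hc : c ^ 6 = 1) (h1 : (a * c) ^ 2 = 1)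
    (h2 : (c * b) ^ 2 = 1) :
    HasORR G ∨ Nonempty (G ≃* Multiplicative (ZMod 3 × (Fin 3 → ZMod 2))) := by
  have k1 : a ^ 2 * c ^ 2 = 1 := by
    rw [← (show Commute a c from hac).mul_pow]; exact h1
  have k2 : c ^ 2 * b ^ 2 = 1 := by
    rw [← (show Commute c b from hcb).mul_pow]; exact h2
  by_cases hab : a * b = b * a
  · right
    have cac : Commute a c := hac
    have cbc : Commute b c := hcb.symm
    have cab : Commute a b := hab
    refine isoX (c := c) (u := a * c) (v := b * c) ?_ ?_ ?_ hc ?_ ?_ h1 ?_ ?_ ?_ ?_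
    · exact (cac.symm.mul_right (Commute.refl c)).eq
    · exact (cbc.symm.mul_right (Commute.refl c)).eq
    · exact ((cab.mul_right cac).mul_left (cbc.symm.mul_right (Commute.refl c))).eq
    · rw [pow_two]; exact h.sq
    · intro h3
      apply h.iq
      have : c = a ^ 2 := by
        rw [mul_eq_one_iff_eq_inv] at k1
        rw [k1, eq_inv_iff_mul_eq_one, ← pow_succ']
        exact h3
      rw [this]
      exact pow_mem (Subgroup.subset_closure (by simp)) 2
    · rw [← hcb]; exact h2
    · intro h'
      apply h.ip
      have h3 : a * c ∈ Subgroup.closure {c, b} := by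
        refine (Subgroup.closure_le _).2 ?_ h'
        rintro x (rfl | rfl)
        · exact mul_mem (Subgroup.subset_closure (by simp)) (Subgroup.subset_closure (by simp))
        · exact Subgroup.subset_closure (by simp)
      exact (Subgroup.mul_mem_cancel_right _ (Subgroup.subset_closure (by simp))).1 h3
    · intro h'
      apply h.ir
      have h3 := zp_le2 a c h'
      exact (Subgroup.mul_mem_cancel_right _ (Subgroup.subset_closure (by simp))).1 h3
    · intro M m1 m2 m3
      exact h.gen M ((Subgroup.mul_mem_cancel_right _ m1).1 m2) m1
        ((Subgroup.mul_mem_cancel_right _ m1).1 m3)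
  · left
    have hs : a * a = b * b := by
      rw [← pow_two, ← pow_two]
      rw [mul_eq_one_iff_eq_inv] at k1
      rw [mul_eq_one_iff_inv_eq] at k2
      rw [k1, k2]
    apply good1' h.swap12 (fun h' => hab (comm_of_sq hs h')) hab
    rintro ⟨hA, _⟩
    have h4 := (q8facts hA hs).1
    apply h.sp
    rw [← pow_two]
    have : a ^ 6 = a ^ 4 * a ^ 2 := by rw [← pow_add]
    rw [ha, h4, one_mul] at this
    exact this.symm

lemma case_Q {a c b : G} (h : Tri a c b) (hac : pA a c) (sac : a * a = c * c) (hcb : pA c b)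
    (scb : c * c = b * b) : HasORR G := by
  obtain ⟨a4, hca⟩ := q8facts hac sac
  obtain ⟨c4, hbc⟩ := q8facts hcb scb
  have ic : c ∉ Subgroup.zpowers a := fun h' => h.iq (zp_le1 _ _ h')
  have sp : a ^ 2 ≠ 1 := by rw [pow_two]; exact h.sp
  have hsab : a * a = b * b := sac.trans scb
  have z2 : a * a * (a * a) = 1 := by rw [← a4]; simp [pow_succ, mul_assoc]
  have ainv : a⁻¹ = a * (a * a) := by rw [inv_eq_iff_mul_eq_one, ← z2]; simp [mul_assoc]
  have cinv : c⁻¹ = c * (a * a) := by rw [inv_eq_iff_mul_eq_one, ← z2, sac]; simp [mul_assoc]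
  have binv : b⁻¹ = b * (a * a) := by rw [inv_eq_iff_mul_eq_one, ← z2, hsab]; simp [mul_assoc]
  have fin : ∀ e : G, e ^ 2 = 1 → a * e = e * a → c * e = e * c → 
      (∀ M : Subgroup G, a ∈ M → c ∈ M → e ∈ M → b ∈ M) → HasORR G := by
    intro e e1 e2 e3 e4
    obtain ⟨f⟩ := isoQ2 a4 hac sac.symm sp ic e1 e2 e3
      (fun h' => h.ir (e4 _ (Subgroup.subset_closure (by simp)) (Subgroup.subset_closure (by simp)) h'))
      (fun M m1 m2 m3 => h.gen M m1 m2 (e4 M m1 m2 m3))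
    exact orr_transfer f.symm orr_Q2
  by_cases hab : a * b = b * a
  · apply fin (b * a⁻¹)
    · have : Commute b a⁻¹ := Commute.inv_right (hab.symm : Commute b a)
      rw [this.mul_pow, inv_pow, pow_two, pow_two, ← hsab, mul_inv_cancel]
    · rw [← mul_assoc, hab]; group
    · have e1 : c⁻¹ * a⁻¹ = c * a := by
        rw [← mul_inv_rev, inv_eq_iff_mul_eq_one]
        calc a * c * (c * a) = a * (c * c) * a := by group
          _ = a * a * (a * a) := by rw [← sac]; group
          _ = 1 := z2
      have e2 : a⁻¹ * c = c * a := by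
        rw [inv_mul_eq_iff_eq_mul, ← mul_assoc, show a * c = c * a⁻¹ from hac, inv_mul_cancel_right]
      rw [← mul_assoc, show c * b = b * c⁻¹ from hcb, mul_assoc, e1, mul_assoc, e2]
    · intro M m1 m2 m3
      exact (Subgroup.mul_mem_cancel_right _ (inv_mem m1)).1 m3
  by_cases hA : pA a b
  swap
  · exact good1' h.swap12 (fun h' => hab (comm_of_sq hsab h')) hab (fun h' => hA h'.1)
  have hba := (q8facts hA hsab).2
  have za : Commute (a * a) a := (Commute.refl a).mul_left (Commute.refl a)
  have zc : Commute (a * a) c := by rw [sac]; exact (Commute.refl c).mul_left (Commute.refl c)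
  have zb : Commute (a * a) b := by rw [hsab]; exact (Commute.refl b).mul_left (Commute.refl b)
  have r1 : c * a = a * c * (a * a) := by rw [show c * a = a * c⁻¹ from hca, cinv, mul_assoc]
  have r2 : b * a = a * b * (a * a) := by rw [show b * a = a * b⁻¹ from hba, binv, mul_assoc]
  have r3 : b * c = c * b * (a * a) := by rw [show b * c = c * b⁻¹ from hbc, binv, mul_assoc]
  have ea : a * (a * c * b) = a * c * b * a := by
    symm
    calc a * c * b * a = a * c * (b * a) := by group
      _ = a * (c * a) * b * (a * a) := by rw [r2]; group
      _ = a * (a * c) * ((a * a) * b) * (a * a) := by rw [r1]; group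
      _ = a * (a * c) * (b * (a * a)) * (a * a) := by rw [zb.eq]
      _ = a * (a * c * b) * (a * a * (a * a)) := by group
      _ = _ := by rw [z2, mul_one]
  have ec : c * (a * c * b) = a * c * b * c := by
    calc c * (a * c * b) = (c * a) * c * b := by group
      _ = a * c * ((a * a) * c) * b := by rw [r1]; group
      _ = a * c * c * ((a * a) * b) := by rw [zc.eq]; group
      _ = a * c * (c * b * (a * a)) := by rw [zb.eq]; group
      _ = _ := by rw [← r3]; group
  apply fin (a * c * b) _ ea ec
  · intro M m1 m2 m3
    exact (Subgroup.mul_mem_cancel_left _ (mul_mem m1 m2)).1 m3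
  · rw [pow_two]
    calc a * c * b * (a * c * b) = (a * c * b * a) * c * b := by group
      _ = a * (a * c * b * c) * b := by rw [← ea]; group
      _ = a * c * a * c * (b * b) := by rw [← ec]; group
      _ = a * (c * a) * c * (a * a) := by rw [← hsab]; group
      _ = a * a * c * ((a * a) * c) * (a * a) := by rw [r1]; group
      _ = a * a * c * (c * (a * a)) * (a * a) :=
          congrArg (fun t => a * a * c * t * (a * a)) zc.eq
      _ = a * a * (c * c) * (a * a * (a * a)) := by group
      _ = 1 := by rw [← sac, z2, mul_one]

lemma three {a c b : G} (h : Tri a c b) (hd0 : (c * a⁻¹) * (c * a⁻¹) ≠ 1)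
    (hd1 : (b * c⁻¹) * (b * c⁻¹) ≠ 1) :
    HasORR G ∨ Nonempty (G ≃* Multiplicative (ZMod 3 × (Fin 3 → ZMod 2))) := by
  have c1 : c ≠ 1 := fun h' => h.sq (by rw [h', one_mul])
  have c2 : c ^ 2 ≠ 1 := by rw [pow_two]; exact h.sq
  have no34 : c ^ 4 = 1 → c ^ 3 = 1 → False := by
    intro h4 h3
    rw [pow_succ, h3, one_mul] at h4
    exact c1 h4
  have no64 : c ^ 4 = 1 → c ^ 6 = 1 → False := by
    intro h4 h6
    have : c ^ 6 = c ^ 4 * c ^ 2 := by rw [← pow_add]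
    rw [h4, h6, one_mul] at this
    exact c2 this.symm
  have T1 : Tri b a c := h.swap23.swap12
  have P1 : HasORR G ∨ (a * c = c * a ∧ ((a ^ 3 = 1 ∧ c ^ 3 = 1) ∨
      (a ^ 6 = 1 ∧ c ^ 6 = 1 ∧ (a * c) ^ 2 = 1))) ∨ (pA a c ∧ a * a = c * c) := by
    by_cases hB : a * c = c * a
    · rcases CP hB (fun h' => h.ip (zp_le1 _ _ h')) (fun h' => h.iq (zp_le1 _ _ h')) h.ir
        h.sr h.sp h.sq hd0 (fun M m1 m2 m3 => h.gen M m2 m3 m1) with h1 | h1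
      · exact Or.inl h1
      · exact Or.inr (Or.inl ⟨hB, h1⟩)
    · by_cases hAC : pA a c ∧ a * a = c * c
      · exact Or.inr (Or.inr hAC)
      · exact Or.inl (good1' T1 hd0 hB hAC)
  have P2 : HasORR G ∨ (c * b = b * c ∧ ((c ^ 3 = 1 ∧ b ^ 3 = 1) ∨
      (c ^ 6 = 1 ∧ b ^ 6 = 1 ∧ (c * b) ^ 2 = 1))) ∨ (pA c b ∧ c * c = b * b) := by
    by_cases hB : c * b = b * c
    · rcases CP hB (fun h' => h.iq (zp_le2 _ _ h')) (fun h' => h.ir (zp_le2 _ _ h')) h.ip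
        h.sp h.sq h.sr hd1 (fun M m1 m2 m3 => h.gen M m1 m2 m3) with h1 | h1
      · exact Or.inl h1
      · exact Or.inr (Or.inl ⟨hB, h1⟩)
    · by_cases hAC : pA c b ∧ c * c = b * b
      · exact Or.inr (Or.inr hAC)
      · exact Or.inl (good1' h hd1 hB hAC)
  rcases P1 with h1 | ⟨h1, h1'⟩ | ⟨h1, h1'⟩
  · exact Or.inl h1
  · rcases P2 with h2 | ⟨h2, h2'⟩ | ⟨h2, h2'⟩
    · exact Or.inl h2
    · rcases h1' with ⟨p1, p2⟩ | ⟨p1, p2, p3⟩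
      · rcases h2' with ⟨q1, q2⟩ | ⟨q1, q2, q3⟩
        · exact Or.inl (case_T h h1 h2 p1 q2 p2)
        · exfalso
          apply h.iq
          have k2 : c ^ 2 * b ^ 2 = 1 := by
            rw [← (show Commute c b from h2).mul_pow]; exact q3
          have : c = b ^ 2 := by
            have k3 : c ^ 2 * c = 1 := by rw [← pow_succ]; exact p2
            exact mul_left_cancel (k3.trans k2.symm)
          rw [this]
          exact pow_mem (Subgroup.subset_closure (by simp)) 2
      · rcases h2' with ⟨q1, q2⟩ | ⟨q1, q2, q3⟩
        · exfalso
          apply h.iq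
          have k2 : a ^ 2 * c ^ 2 = 1 := by
            rw [← (show Commute a c from h1).mul_pow]; exact p3
          have : c = a ^ 2 := by
            have k3 : c * c ^ 2 = 1 := by rw [← pow_succ']; exact q1
            exact mul_right_cancel (k3.trans k2.symm)
          rw [this]
          exact pow_mem (Subgroup.subset_closure (by simp)) 2
        · exact case_X h h1 h2 p1 q2 p2 p3 q3
    · exfalso
      have c4 := (q8facts h2 h2').1
      rcases h1' with ⟨p1, p2⟩ | ⟨p1, p2, p3⟩
      · exact no34 c4 p2
      · exact no64 c4 p2
  · rcases P2 with h2 | ⟨h2, h2'⟩ | ⟨h2, h2'⟩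
    · exact Or.inl h2
    · exfalso
      have c4 := (q8facts (q8facts h1 h1').2 h1'.symm).1
      rcases h2' with ⟨p1, p2⟩ | ⟨p1, p2, p3⟩
      · exact no34 c4 p1
      · exact no64 c4 p1
    · exact Or.inl (case_Q h h1 h1' h2 h2')

end ORR


namespace ORR

variable {G : Type*} [Group G]

lemma sq_ne {a : G} (h : 2 < orderOf a) : a * a ≠ 1 := by
  intro h'
  have := orderOf_le_of_pow_eq_one (x := a) (n := 2) (by norm_num) (by rw [pow_two]; exact h')
  omega

/-- Extension of a tuple to a sequence. -/
def ext (d : ℕ) (g : Fin d → G) : ℕ → G := fun i => if h : i < d then g ⟨i, h⟩ else 1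

lemma ext_lt {d : ℕ} {g : Fin d → G} {i : ℕ} (h : i < d) : ext d g i = g ⟨i, h⟩ := by
  simp [ext, h]

lemma ext_gen {d : ℕ} {g : Fin d → G} (hg : IsBeautiful g) :
    Subgroup.closure {y | ∃ j < d, ext d g j = y} = ⊤ := by
  rw [eq_top_iff, ← hg.1, Subgroup.closure_le]
  rintro _ ⟨i, rfl⟩
  exact Subgroup.subset_closure ⟨i, i.2, ext_lt i.2⟩

lemma ext_pd {d : ℕ} {g : Fin d → G} (hg : IsBeautiful g) : PD0 (ext d g) d 0 := by
  refine ⟨fun k => Or.inl ⟨rfl, rfl⟩, ?_, ?_, ?_⟩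
  · intro i hi h'
    apply hg.2.1 ⟨i, hi⟩
    rw [eq_top_iff, ← hg.1, Subgroup.closure_le]
    rintro _ ⟨j, rfl⟩
    by_cases hj : j = ⟨i, hi⟩
    · subst hj
      rw [ext_lt hi] at h'
      refine (Subgroup.closure_le _).2 ?_ h'
      rintro _ ⟨k, hk, hki, rfl⟩
      rw [ext_lt hk]
      exact Subgroup.subset_closure ⟨⟨k, hk⟩, fun h => hki (congrArg Fin.val h), rfl⟩
    · exact Subgroup.subset_closure ⟨j, hj, rfl⟩
  · intro i hi
    rw [ext_lt hi]
    exact sq_ne (hg.2.2.1 _)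
  · intro k _ hk
    have := sq_ne (hg.2.2.2 k hk)
    change (ext d g (k + 1) * (ext d g k)⁻¹) * (ext d g (k + 1) * (ext d g k)⁻¹) ≠ 1
    rw [ext_lt hk, ext_lt (Nat.lt_of_succ_lt hk)]
    exact this

lemma main_cases {d : ℕ} {x : ℕ → G} (h : PD0 x d 0)
    (hg : Subgroup.closure {y | ∃ j < d, x j = y} = ⊤) :
    HasORR G ∨ Nonempty (G ≃* QuaternionGroup 2) ∨
      Nonempty (G ≃* Multiplicative (ZMod 3 × (Fin 3 → ZMod 2))) ∨
      Nonempty (G ≃* Multiplicative (ZMod 3 × ZMod 3)) := by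
  have hgen : ∀ M : Subgroup G, (∀ j < d, x j ∈ M) → M = ⊤ := by
    intro M hM
    rw [eq_top_iff, ← hg, Subgroup.closure_le]
    rintro _ ⟨j, hj, rfl⟩
    exact hM j hj
  by_cases h4 : 4 ≤ d
  · exact Or.inl (orr_ge4 h h4 hg)
  have hd : d < 4 := by omega
  clear h4
  interval_cases d
  · exact Or.inl (orr_trivial fun M => hgen M (by intro j hj; omega))
  · refine Or.inl (orr_cyclic (h := x 0) (h.sq 0 (by norm_num)) fun M hM => hgen M ?_)
    intro j hj
    interval_cases j
    exact hM
  · rcases two h hg with h1 | h1 | h1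
    · exact Or.inl h1
    · exact Or.inr (Or.inl h1)
    · exact Or.inr (Or.inr (Or.inr h1))
  · have sub : ∀ i j k : ℕ, j < 3 → k < 3 → j ≠ i → k ≠ i →
        Subgroup.closure {x j, x k} ≤ Subgroup.closure {g | ∃ j < 3, j ≠ i ∧ x j = g} := by
      intro i j k hj hk hji hki
      rw [Subgroup.closure_le]
      rintro y (rfl | rfl)
      · exact Subgroup.subset_closure ⟨j, hj, hji, rfl⟩
      · exact Subgroup.subset_closure ⟨k, hk, hki, rfl⟩
    have T : Tri (x 0) (x 1) (x 2) := by
      refine ⟨fun h' => h.irr 0 (by norm_num) (sub 0 1 2 ?_ ?_ ?_ ?_ h'),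
        fun h' => h.irr 1 (by norm_num) (sub 1 0 2 ?_ ?_ ?_ ?_ h'),
        fun h' => h.irr 2 (by norm_num) (sub 2 0 1 ?_ ?_ ?_ ?_ h'),
        h.sq 0 (by norm_num), h.sq 1 (by norm_num), h.sq 2 (by norm_num), ?_⟩
      all_goals try norm_num
      intro M m0 m1 m2
      apply hgen
      intro j hj
      interval_cases j
      · exact m0
      · exact m1
      · exact m2
    rcases three T (h.hsq 0 le_rfl (by norm_num)) (h.hsq 1 (by norm_num) (by norm_num)) with h1 | h1
    · exact Or.inl h1
    · exact Or.inr (Or.inr (Or.inl h1))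

end ORR

/-- A finite group admitting a beautiful generating tuple admits an oriented regular
representation if and only if it is not isomorphic to `Q₈`, to `C₃ × C₂³`,
or to `C₃ × C₃`. -/
theorem hasORR_iff_of_beautiful {G : Type*} [Group G] [Finite G]
    (d : ℕ) (g : Fin d → G) (hg : IsBeautiful g) :
    HasORR G ↔
      (¬ Nonempty (G ≃* QuaternionGroup 2) ∧
       ¬ Nonempty (G ≃* Multiplicative (ZMod 3 × (Fin 3 → ZMod 2))) ∧
       ¬ Nonempty (G ≃* Multiplicative (ZMod 3 × ZMod 3))) := by
  constructor
  · intro h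
    refine ⟨?_, ?_, ?_⟩
    · rintro ⟨e⟩
      exact ORR.no_Q (ORR.orr_transfer e h)
    · rintro ⟨e⟩
      exact ORR.no_X (ORR.orr_transfer e h)
    · rintro ⟨e⟩
      exact ORR.no_33 (ORR.orr_transfer e h)
  · rintro ⟨h1, h2, h3⟩
    rcases ORR.main_cases (ORR.ext_pd hg) (ORR.ext_gen hg) with h | h | h | h
    · exact h
    · exact absurd h h1
    · exact absurd h h2
    · exact absurd h h3
end
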